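/- For every iterated sequence S for Gr(3,6), the initial ideal In_{M_S}(𝓘_{3,6}) ⊂ ℂ[p_K : K ∈ I_{3,6}] is a toric ideal: it is generated by binomials (polynomials with exactly two terms) and it is a prime ideal. -/

import Mathlib

/-!
Common framework: iterated sequences for Gr(3,n), the matrix `A_S`, pullbacks of
Plücker coordinates, the weighted reverse lexicographic order, lowest-term
valuations, Plücker relations, weighting matrices and initial ideals.
-/

open MvPolynomial

noncomputable section

/-- Height of a positive root `(i,j) ↦ j - i`. -/
def Ht (β : ℕ × ℕ) : ℕ := β.2 - β.1

/-- `IsIter n S` : `S` is an iterated sequence for `Gr(3,n)`: it starts (as base of the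
iteration) from a PBW sequence for `Gr(3,4)`, i.e. an ordering of `((1,4),(2,4),(3,4))`,
and for each `r = 5, …, n` a triple `((i₁,r),(i₂,r),(i₃,r))` with `i₁,i₂,i₃ ∈ [r-1]`
pairwise distinct is prepended. -/
inductive IsIter : ℕ → List (ℕ × ℕ) → Prop
  | base (L : List (ℕ × ℕ)) : L.Perm [(1,4),(2,4),(3,4)] → IsIter 4 L
  | step (r : ℕ) (L : List (ℕ × ℕ)) (i₁ i₂ i₃ : ℕ) :
      4 ≤ r → IsIter r L →
      1 ≤ i₁ → i₁ ≤ r → 1 ≤ i₂ → i₂ ≤ r → 1 ≤ i₃ → i₃ ≤ r →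
      i₁ ≠ i₂ → i₁ ≠ i₃ → i₂ ≠ i₃ →
      IsIter (r+1) ((i₁, r+1) :: (i₂, r+1) :: (i₃, r+1) :: L)

/-- `Sorted k n I` : `I ∈ I_{k,n}`, a strictly increasing `k`-tuple in `{1,…,n}`. -/
def Sorted (k n : ℕ) (I : Fin k → ℕ) : Prop :=
  StrictMono I ∧ ∀ a, 1 ≤ I a ∧ I a ≤ n

/-- `ℕ`-indexed square "matrices" (1-based indexing, size given by a parameter `n`). -/
abbrev NMat := ℕ → ℕ → MvPolynomial (ℕ × ℕ) ℂ

/-- Product of two `n × n` matrices, 1-based indexing. -/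
def matMul (n : ℕ) (A B : NMat) : NMat := fun i j => ∑ k ∈ Finset.Icc 1 n, A i k * B k j

/-- Identity matrix. -/
def idN : NMat := fun i j => if i = j then 1 else 0

/-- The factor `1 + x_β f_β`, where `f_β` is the matrix unit in entry `β = (i,j)`. -/
def factor (β : ℕ × ℕ) : NMat := fun i j =>
  (if i = j then (1 : MvPolynomial (ℕ × ℕ) ℂ) else 0) +
    (if i = β.1 ∧ j = β.2 then (MvPolynomial.X β : MvPolynomial (ℕ × ℕ) ℂ) else 0)

/-- `A_S := (1 + x_{β_N} f_{β_N}) ⋯ (1 + x_{β_1} f_{β_1})` for `S = (β_1, …, β_N)`. -/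
def ASmat (n : ℕ) : List (ℕ × ℕ) → NMat
  | [] => idN
  | β :: L => matMul n (ASmat n L) (factor β)

/-- `φ_S^*(p̄_I)` : the determinant of the `3×3` submatrix of `A_S` on rows `(1,2,3)`
and columns `I = (i₁,i₂,i₃)`. -/
def phiStar (n : ℕ) (S : List (ℕ × ℕ)) (I : Fin 3 → ℕ) : MvPolynomial (ℕ × ℕ) ℂ :=
  Matrix.det (Matrix.of fun a b : Fin 3 => ASmat n S (a.val + 1) (I b))

/-- `Ψ_S(a) = Σ_l a_l Ht(β_l)`, the height-weighted function (written on exponents). -/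
def Psi (d : (ℕ × ℕ) →₀ ℕ) : ℕ := d.sum fun β c => c * Ht β

/-- `a <_lex b` : lexicographic comparison of exponent vectors, the coordinates being
read in the order `β_1, …, β_N` of the sequence `S`. -/
def lexLT (S : List (ℕ × ℕ)) (a b : (ℕ × ℕ) →₀ ℕ) : Prop :=
  ∃ k < S.length, (∀ m < k, a (S.getD m (0,0)) = b (S.getD m (0,0))) ∧
    a (S.getD k (0,0)) < b (S.getD k (0,0))

/-- `a ≤_lex b` on coordinates indexed by `S`. -/
def lexLE (S : List (ℕ × ℕ)) (a b : (ℕ × ℕ) →₀ ℕ) : Prop :=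
  lexLT S a b ∨ ∀ k < S.length, a (S.getD k (0,0)) = b (S.getD k (0,0))

/-- `a ≺_{Ψ_S} b` : the strict `Ψ_S`-weighted reverse lexicographic order:
`Ψ_S(a) < Ψ_S(b)`, or `Ψ_S(a) = Ψ_S(b)` and `a >_lex b`. -/
def psiLT (S : List (ℕ × ℕ)) (a b : (ℕ × ℕ) →₀ ℕ) : Prop :=
  Psi a < Psi b ∨ (Psi a = Psi b ∧ lexLT S b a)

/-- `a ⪯_{Ψ_S} b`. -/
def psiLE (S : List (ℕ × ℕ)) (a b : (ℕ × ℕ) →₀ ℕ) : Prop :=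
  Psi a < Psi b ∨ (Psi a = Psi b ∧ lexLE S b a)

open scoped Classical in
/-- The `⪯_{Ψ_S}`-minimum of the support of a polynomial (defaulting to `0` if no
minimum exists). -/
def minSupp (S : List (ℕ × ℕ)) (f : MvPolynomial (ℕ × ℕ) ℂ) : (ℕ × ℕ) →₀ ℕ :=
  if h : ∃ m ∈ f.support, ∀ m' ∈ f.support, psiLE S m m' then h.choose else 0

/-- The lowest-term valuation `v_S(p̄_I)` : the `⪯_{Ψ_S}`-minimum of the support of
`φ_S^*(p̄_I)`. -/
def valS (n : ℕ) (S : List (ℕ × ℕ)) (I : Fin 3 → ℕ) : (ℕ × ℕ) →₀ ℕ :=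
  minSupp S (phiStar n S I)

/-- The index set `I_{3,n}` of Plücker variables. -/
abbrev MI (n : ℕ) := {v : Fin 3 → ℕ // Sorted 3 n v}

/-- The Plücker polynomial ring `ℂ[p_K : K ∈ I_{3,n}]`. -/
abbrev PRing (n : ℕ) := MvPolynomial (MI n) ℂ

open scoped Classical in
/-- The Plücker variable `p_K`, defined to be `0` if `K` is not strictly increasing
(in particular `p_{I ∪ j} = 0` if `j ∈ I`). -/
def pvar (n : ℕ) (K : Fin 3 → ℕ) : PRing n :=
  if h : Sorted 3 n K then MvPolynomial.X (⟨K, h⟩ : MI n) else 0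

/-- `I ∪ j` : the sorted triple obtained by adjoining `j` to the pair `I`. -/
def insert3 (I : Fin 2 → ℕ) (j : ℕ) : Fin 3 → ℕ :=
  fun a => (List.insertionSort (· ≤ ·) [I 0, I 1, j]).getD a 0

/-- `J ∖ j` : the sorted triple obtained by removing `j` from the 4-tuple `J`. -/
def erase4 (J : Fin 4 → ℕ) (j : ℕ) : Fin 3 → ℕ :=
  fun a => (([J 0, J 1, J 2, J 3]).erase j).getD a 0

/-- The Plücker relation
`R_{I,J} = Σ_{j ∈ J} (−1)^{#{i∈I : i<j} + #{j'∈J : j<j'}} p_{I∪j} p_{J∖j}`. -/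
def Rrel (n : ℕ) (I : Fin 2 → ℕ) (J : Fin 4 → ℕ) : PRing n :=
  ∑ a : Fin 4,
    (-1 : PRing n) ^ ((Finset.univ.filter fun b : Fin 2 => I b < J a).card +
        (Finset.univ.filter fun b : Fin 4 => J a < J b).card) *
      (pvar n (insert3 I (J a)) * pvar n (erase4 J (J a)))

/-- The Plücker ideal `𝓘_{3,n}`, generated by all Plücker relations. -/
def PluckerIdeal (n : ℕ) : Ideal (PRing n) :=
  Ideal.span {f | ∃ I J, Sorted 2 n I ∧ Sorted 4 n J ∧ f = Rrel n I J}

/-- `M_S · m = Σ_K m_K v_S(p̄_K)` : the weighting matrix applied to an exponent. -/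
def MSdot (n : ℕ) (S : List (ℕ × ℕ)) (m : MI n →₀ ℕ) : (ℕ × ℕ) →₀ ℕ :=
  m.sum fun K c => c • valS n S K.val

open scoped Classical in
/-- The initial form `In_{M_S}(f)` : the sum of the terms of `f` whose `M_S`-weight is
`⪯_{Ψ_S}`-minimal. -/
def inM (n : ℕ) (S : List (ℕ × ℕ)) (f : PRing n) : PRing n :=
  ∑ m ∈ f.support.filter fun m => ∀ m' ∈ f.support, psiLE S (MSdot n S m) (MSdot n S m'),
    MvPolynomial.monomial m (f.coeff m)

/-- The initial ideal `In_{M_S}(𝓘_{3,n}) = ⟨In_{M_S}(g) : g ∈ 𝓘_{3,n}, g ≠ 0⟩`. -/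
def InIdeal (n : ℕ) (S : List (ℕ × ℕ)) : Ideal (PRing n) :=
  Ideal.span {g | ∃ f, f ∈ PluckerIdeal n ∧ f ≠ 0 ∧ g = inM n S f}

/-- Evaluation of the `ℤ`-linear functional with coefficients `c` on an exponent
vector (i.e. an element `e ∈ (ℤ^{3(n-3)})^*` given by its coefficients). -/
def evalF (c : ℕ × ℕ → ℤ) (d : (ℕ × ℕ) →₀ ℕ) : ℤ := d.sum fun β m => c β * (m : ℤ)

/-- `v_S(p̄_{I∪j}) + v_S(p̄_{J∖j})`, the `M_S`-weight of the term of `R_{I,J}`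
corresponding to `j = J a`. -/
def wvec (n : ℕ) (S : List (ℕ × ℕ)) (I : Fin 2 → ℕ) (J : Fin 4 → ℕ) (a : Fin 4) :
    (ℕ × ℕ) →₀ ℕ :=
  valS n S (insert3 I (J a)) + valS n S (erase4 J (J a))

/-- A `ℤ`-linear functional `e` (given by its coefficients `c`) *preserves inequalities*
with respect to `S` if for every nonzero Plücker relation `R_{I,J}` and all
`s₁, s₂ ∈ J ∖ I`, `v_S(p̄_{I∪s₁}) + v_S(p̄_{J∖s₁}) ≺_{Ψ_S} v_S(p̄_{I∪s₂}) + v_S(p̄_{J∖s₂})`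
implies the corresponding strict inequality of the values of `e`. -/
def PreservesIneq (n : ℕ) (S : List (ℕ × ℕ)) (c : ℕ × ℕ → ℤ) : Prop :=
  ∀ (I : Fin 2 → ℕ) (J : Fin 4 → ℕ), Sorted 2 n I → Sorted 4 n J → Rrel n I J ≠ 0 →
    ∀ a b : Fin 4, (∀ t : Fin 2, I t ≠ J a) → (∀ t : Fin 2, I t ≠ J b) →
      psiLT S (wvec n S I J a) (wvec n S I J b) →
      evalF c (wvec n S I J a) < evalF c (wvec n S I J b)

end

namespace Gr36

/-- The level of position `x`. -/
def level (a b c x : ℕ) : ℕ :=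
  bif x == a then 0 else bif x == b then 1 else bif x == c then 2 else 3

def admissible (a b c : ℕ) (t : ℕ × ℕ × ℕ) : Bool :=
  t.1.blt t.2.1 && t.2.1.blt 5 && t.2.2.ble (level a b c t.1) && t.2.2.ble (level a b c t.2.1)

def exchanges (a b c : ℕ) (t p q : ℕ × ℕ × ℕ) : Bool :=
  (t.1 == p.1 || t.1 == q.1) && (t.2.1 == p.2.1 || t.2.1 == q.2.1) &&
  (t.2.2 == p.2.2 || t.2.2 == q.2.2) &&
  admissible a b c (p.1 + q.1 - t.1, p.2.1 + q.2.1 - t.2.1, p.2.2 + q.2.2 - t.2.2)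

def tripEq (p q : ℕ × ℕ × ℕ) : Bool := p.1 == q.1 && p.2.1 == q.2.1 && p.2.2 == q.2.2

def mixes (p q : ℕ × ℕ × ℕ) : List (ℕ × ℕ × ℕ) :=
  [(p.1, p.2.1, q.2.2), (p.1, q.2.1, p.2.2), (p.1, q.2.1, q.2.2),
   (q.1, p.2.1, p.2.2), (q.1, p.2.1, q.2.2), (q.1, q.2.1, p.2.2)]

def exchanges₂ (a b c : ℕ) (t p q r : ℕ × ℕ × ℕ) : Bool :=
  (mixes p q).any fun u => admissible a b c u && (exchanges a b c u p q && exchanges a b c t u r)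

def reachable (a b c : ℕ) (t p q r : ℕ × ℕ × ℕ) : Bool :=
  (!tripEq p r && exchanges a b c t p r) || ((!tripEq q r && exchanges a b c t q r) ||
  (!tripEq p q && (!tripEq p r && (!tripEq q r && (exchanges₂ a b c t p q r ||
    (exchanges₂ a b c t p r q || exchanges₂ a b c t q r p))))))

def peelable (a b c : ℕ) (t : ℕ × ℕ × ℕ) (R : List (ℕ × ℕ × ℕ)) : Bool :=
  R.all fun p => !(p.1 == t.1) || R.all fun q => !(q.2.1 == t.2.1) ||
    ((!tripEq p q && exchanges a b c t p q) ||
    R.all fun r => !(r.2.2 == t.2.2) || reachable a b c t p q r)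

def peelsAll (a b c : ℕ) : List (ℕ × ℕ × ℕ) → Bool
  | [] => true
  | t :: R => peelable a b c t R && peelsAll a b c R

def peelOrder : List (ℕ × ℕ × ℕ) :=
  [(0,1,3), (0,2,3), (0,3,3), (0,4,3), (1,2,3), (1,3,3), (1,4,3), (2,3,3), (2,4,3), (3,4,3),
   (0,1,2), (1,2,2), (2,3,2), (3,4,2), (1,3,2), (0,1,1), (3,4,1), (0,1,0), (0,2,2), (0,3,2),
   (2,4,2), (0,4,2), (1,4,2), (0,2,1), (1,2,1), (2,3,1), (3,4,0), (2,4,1), (0,3,1), (0,4,1),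
   (1,3,1), (1,4,1), (0,2,0), (0,3,0), (0,4,0), (1,2,0), (1,3,0), (1,4,0), (2,3,0), (2,4,0)]

def positionTriples : List (ℕ × ℕ × ℕ) :=
  (List.range 5).flatMap fun a => (List.range 5).flatMap fun b =>
    (List.range 5).flatMap fun c => if a ≠ b ∧ a ≠ c ∧ b ≠ c then [(a, b, c)] else []

/-- Two multisets of triples with the same multisets of coordinates. -/
def SameMargins (s s' : Multiset (ℕ × ℕ × ℕ)) : Prop :=
  s.map (fun t => t.1) = s'.map (fun t => t.1) ∧
  s.map (fun t => t.2.1) = s'.map (fun t => t.2.1) ∧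
  s.map (fun t => t.2.2) = s'.map (fun t => t.2.2)

theorem SameMargins.symm {s s' : Multiset (ℕ × ℕ × ℕ)} (h : SameMargins s s') :
    SameMargins s' s := ⟨h.1.symm, h.2.1.symm, h.2.2.symm⟩

theorem SameMargins.trans {s s' s'' : Multiset (ℕ × ℕ × ℕ)} (h : SameMargins s s')
    (h' : SameMargins s' s'') : SameMargins s s'' :=
  ⟨h.1.trans h'.1, h.2.1.trans h'.2.1, h.2.2.trans h'.2.2⟩

theorem SameMargins.of_cons {t : ℕ × ℕ × ℕ} {s s' : Multiset (ℕ × ℕ × ℕ)}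
    (h : SameMargins (t ::ₘ s) (t ::ₘ s')) : SameMargins s s' := by
  simpa [SameMargins] using h

theorem SameMargins.add_right {s s' : Multiset (ℕ × ℕ × ℕ)} (h : SameMargins s s')
    (w : Multiset (ℕ × ℕ × ℕ)) : SameMargins (s + w) (s' + w) := by
  simpa [SameMargins] using h

theorem SameMargins.card_eq {s s' : Multiset (ℕ × ℕ × ℕ)} (h : SameMargins s s') :
    s.card = s'.card := by
  simpa using congrArg Multiset.card h.1

theorem pair_eq_of_mem {x y z : ℕ} (h : z = x ∨ z = y) :
    ({z, x + y - z} : Multiset ℕ) = {x, y} := by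
  rcases h with rfl | rfl
  · rw [Nat.add_sub_cancel_left]
  · rw [Nat.add_sub_cancel, Multiset.pair_comm]

theorem exchanges_sound {a b c : ℕ} {t p q : ℕ × ℕ × ℕ} (h : exchanges a b c t p q = true) :
    ∃ u, admissible a b c u = true ∧ SameMargins {t, u} {p, q} := by
  simp only [exchanges, Bool.and_eq_true, Bool.or_eq_true, beq_iff_eq] at h
  obtain ⟨⟨⟨h1, h2⟩, h3⟩, h4⟩ := h
  refine ⟨_, h4, ?_, ?_, ?_⟩
  · simpa using pair_eq_of_mem h1
  · simpa using pair_eq_of_mem h2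
  · simpa using pair_eq_of_mem h3

/-- Fibre elements are identified by every multiplicative function identifying
quadratic fibres. -/
def RespectsPairs {A : Type*} [CommMonoid A] (a b c : ℕ) (f : ℕ × ℕ × ℕ → A) : Prop :=
  ∀ p q u v, admissible a b c p = true → admissible a b c q = true →
    admissible a b c u = true → admissible a b c v = true →
    SameMargins {u, v} {p, q} → f u * f v = f p * f q

theorem exists_cons_of_exchanges {A : Type*} [CommMonoid A] {a b c : ℕ} {f : ℕ × ℕ × ℕ → A}
    (hf : RespectsPairs a b c f) {t p q : ℕ × ℕ × ℕ} {w : Multiset (ℕ × ℕ × ℕ)}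
    (ht : admissible a b c t = true)
    (hs : ∀ x ∈ p ::ₘ q ::ₘ w, admissible a b c x = true)
    (h : exchanges a b c t p q = true) :
    ∃ u, (∀ x ∈ t ::ₘ u ::ₘ w, admissible a b c x = true) ∧
      SameMargins (t ::ₘ u ::ₘ w) (p ::ₘ q ::ₘ w) ∧
      ((t ::ₘ u ::ₘ w).map f).prod = ((p ::ₘ q ::ₘ w).map f).prod := by
  obtain ⟨u, hu, hm⟩ := exchanges_sound h
  have hp := hs p (by simp)
  have hq := hs q (by simp)
  refine ⟨u, ?_, ?_, ?_⟩
  · intro x hx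
    simp only [Multiset.mem_cons] at hx
    rcases hx with rfl | rfl | hx
    · exact ht
    · exact hu
    · exact hs x (by simp [hx])
  · have := hm.add_right w
    simpa using this
  · have := hf p q t u hp hq ht hu hm
    simp only [Multiset.map_cons, Multiset.prod_cons, ← mul_assoc, this]

theorem exists_cons_cons {α : Type*} {p q : α} {s : Multiset α} (hp : p ∈ s) (hq : q ∈ s)
    (h : p ≠ q) : ∃ w, s = p ::ₘ q ::ₘ w := by
  obtain ⟨w, rfl⟩ := Multiset.exists_cons_of_mem hp
  obtain hq := (Multiset.mem_cons.1 hq).resolve_left (Ne.symm h)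
  obtain ⟨v, rfl⟩ := Multiset.exists_cons_of_mem hq
  exact ⟨v, rfl⟩

theorem exists_cons_cons_cons {α : Type*} {p q r : α} {s : Multiset α} (hp : p ∈ s) (hq : q ∈ s)
    (hr : r ∈ s) (hpq : p ≠ q) (hpr : p ≠ r) (hqr : q ≠ r) :
    ∃ w, s = p ::ₘ q ::ₘ r ::ₘ w := by
  obtain ⟨w, rfl⟩ := exists_cons_cons hp hq hpq
  simp only [Multiset.mem_cons] at hr
  obtain ⟨v, rfl⟩ := Multiset.exists_cons_of_mem ((hr.resolve_left hpr.symm).resolve_left hqr.symm)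
  exact ⟨v, rfl⟩

/-- `t` can be brought into `s` without changing the margins or the product. -/
def CanAbsorb {A : Type*} [CommMonoid A] (a b c : ℕ) (f : ℕ × ℕ × ℕ → A) (t : ℕ × ℕ × ℕ)
    (s : Multiset (ℕ × ℕ × ℕ)) : Prop :=
  ∃ w, (∀ x ∈ t ::ₘ w, admissible a b c x = true) ∧ SameMargins (t ::ₘ w) s ∧
    ((t ::ₘ w).map f).prod = (s.map f).prod

theorem canAbsorb_of_exchanges {A : Type*} [CommMonoid A] {a b c : ℕ} {f : ℕ × ℕ × ℕ → A}
    (hf : RespectsPairs a b c f) {t p q : ℕ × ℕ × ℕ} {s : Multiset (ℕ × ℕ × ℕ)}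
    (ht : admissible a b c t = true) (hs : ∀ x ∈ s, admissible a b c x = true)
    (hp : p ∈ s) (hq : q ∈ s) (hpq : p ≠ q) (h : exchanges a b c t p q = true) :
    CanAbsorb a b c f t s := by
  obtain ⟨w, rfl⟩ := exists_cons_cons hp hq hpq
  obtain ⟨u, h1, h2, h3⟩ := exists_cons_of_exchanges hf ht hs h
  exact ⟨_, h1, h2, h3⟩

theorem canAbsorb_of_exchanges₂ {A : Type*} [CommMonoid A] {a b c : ℕ} {f : ℕ × ℕ × ℕ → A}
    (hf : RespectsPairs a b c f) {t p q r : ℕ × ℕ × ℕ} {s : Multiset (ℕ × ℕ × ℕ)}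
    (ht : admissible a b c t = true) (hs : ∀ x ∈ s, admissible a b c x = true)
    (hp : p ∈ s) (hq : q ∈ s) (hr : r ∈ s) (hpq : p ≠ q) (hpr : p ≠ r) (hqr : q ≠ r)
    (h : exchanges₂ a b c t p q r = true) : CanAbsorb a b c f t s := by
  obtain ⟨w, rfl⟩ := exists_cons_cons_cons hp hq hr hpq hpr hqr
  simp only [exchanges₂, List.any_eq_true, Bool.and_eq_true] at h
  obtain ⟨u, -, hu, h1, h2⟩ := h
  obtain ⟨v, k1, k2, k3⟩ := exists_cons_of_exchanges hf hu hs h1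
  have e : u ::ₘ v ::ₘ r ::ₘ w = u ::ₘ r ::ₘ v ::ₘ w := by rw [Multiset.cons_swap v r]
  rw [e] at k1 k2 k3
  obtain ⟨v', l1, l2, l3⟩ := exists_cons_of_exchanges hf ht k1 h2
  exact ⟨_, l1, l2.trans k2, l3.trans k3⟩

theorem tripEq_eq_false {p q : ℕ × ℕ × ℕ} (h : (!tripEq p q) = true) : p ≠ q := by
  rintro rfl
  simp [tripEq] at h

theorem canAbsorb_of_peelable {A : Type*} [CommMonoid A] {a b c : ℕ} {f : ℕ × ℕ × ℕ → A}
    (hf : RespectsPairs a b c f) {t : ℕ × ℕ × ℕ} {R : List (ℕ × ℕ × ℕ)}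
    (hR : peelable a b c t R = true) {s s' : Multiset (ℕ × ℕ × ℕ)}
    (ht : admissible a b c t = true) (hs : ∀ x ∈ s, admissible a b c x = true)
    (hsR : ∀ x ∈ s, x ∈ R) (hts : t ∈ s') (hss : SameMargins s' s) :
    CanAbsorb a b c f t s := by
  have h1 : t.1 ∈ s.map (fun t => t.1) := hss.1 ▸ Multiset.mem_map_of_mem _ hts
  have h2 : t.2.1 ∈ s.map (fun t => t.2.1) := hss.2.1 ▸ Multiset.mem_map_of_mem _ hts
  have h3 : t.2.2 ∈ s.map (fun t => t.2.2) := hss.2.2 ▸ Multiset.mem_map_of_mem _ hts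
  obtain ⟨p, hp, ep⟩ := Multiset.mem_map.1 h1
  obtain ⟨q, hq, eq⟩ := Multiset.mem_map.1 h2
  obtain ⟨r, hr, er⟩ := Multiset.mem_map.1 h3
  have key := List.all_eq_true.1 hR p (hsR p hp)
  simp only [ep, beq_self_eq_true, Bool.not_true, Bool.false_or] at key
  have key := List.all_eq_true.1 key q (hsR q hq)
  simp only [eq, beq_self_eq_true, Bool.not_true, Bool.false_or] at key
  rw [Bool.or_eq_true, Bool.and_eq_true] at key
  rcases key with ⟨n, e⟩ | key
  · exact canAbsorb_of_exchanges hf ht hs hp hq (tripEq_eq_false n) e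
  have key := List.all_eq_true.1 key r (hsR r hr)
  simp only [er, beq_self_eq_true, Bool.not_true, Bool.false_or] at key
  simp only [reachable, Bool.or_eq_true, Bool.and_eq_true] at key
  rcases key with ⟨n, e⟩ | ⟨n, e⟩ | ⟨n1, n2, n3, e⟩
  · exact canAbsorb_of_exchanges hf ht hs hp hr (tripEq_eq_false n) e
  · exact canAbsorb_of_exchanges hf ht hs hq hr (tripEq_eq_false n) e
  replace n1 := tripEq_eq_false n1
  replace n2 := tripEq_eq_false n2
  replace n3 := tripEq_eq_false n3
  rcases e with e | e | e
  · exact canAbsorb_of_exchanges₂ hf ht hs hp hq hr n1 n2 n3 e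
  · exact canAbsorb_of_exchanges₂ hf ht hs hp hr hq n2 n1 n3.symm e
  · exact canAbsorb_of_exchanges₂ hf ht hs hq hr hp n3 n1.symm n2.symm e

theorem prod_eq_of_peelsAll {A : Type*} [CommMonoid A] {a b c : ℕ} {f : ℕ × ℕ × ℕ → A}
    (hf : RespectsPairs a b c f) {T : List (ℕ × ℕ × ℕ)}
    (hT : ∀ t, t ∈ T ↔ admissible a b c t = true) (hp : peelsAll a b c T = true) (n : ℕ) :
    ∀ s s' : Multiset (ℕ × ℕ × ℕ), s.card = n → (∀ x ∈ s, admissible a b c x = true) →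
      (∀ x ∈ s', admissible a b c x = true) → SameMargins s s' →
      (s.map f).prod = (s'.map f).prod := by
  induction n with
  | zero =>
    intro s s' h0 _ _ h
    have h0' := h.card_eq
    rw [h0] at h0'
    rw [Multiset.card_eq_zero.1 h0, Multiset.card_eq_zero.1 h0'.symm]
  | succ n ih =>
    have step : ∀ t s s', (t ::ₘ s).card = n + 1 →
        (∀ x ∈ t ::ₘ s, admissible a b c x = true) → SameMargins (t ::ₘ s) s' →
        CanAbsorb a b c f t s' → ((t ::ₘ s).map f).prod = (s'.map f).prod := by
      rintro t s s' hn hs h ⟨w, hw, hm, hprod⟩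
      rw [← hprod, Multiset.map_cons, Multiset.map_cons, Multiset.prod_cons, Multiset.prod_cons]
      rw [ih s w (by simpa using hn) (fun x hx => hs x (by simp [hx]))
        (fun x hx => hw x (by simp [hx])) (h.trans hm.symm).of_cons]
    have main : ∀ R : List (ℕ × ℕ × ℕ), peelsAll a b c R = true →
        (∀ t ∈ R, admissible a b c t = true) → ∀ s s' : Multiset (ℕ × ℕ × ℕ), s.card = n + 1 →
        (∀ x ∈ s, x ∈ R) → (∀ x ∈ s', x ∈ R) → SameMargins s s' →
        (s.map f).prod = (s'.map f).prod := by
      intro R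
      induction R with
      | nil =>
        intro _ _ s s' hn hs _ _
        rw [Multiset.eq_zero_of_forall_notMem (s := s) fun x hx => by simpa using hs x hx] at hn
        simp at hn
      | cons t R ihR =>
        intro hpeel hR s s' hn hs hs' h
        rw [peelsAll, Bool.and_eq_true] at hpeel
        have absorb : ∀ s s' : Multiset (ℕ × ℕ × ℕ), (∀ x ∈ s, x ∈ t :: R) →
            SameMargins s' s → t ∈ s' → CanAbsorb a b c f t s := by
          intro s s' hs h hts
          by_cases hts' : t ∈ s
          · obtain ⟨w, rfl⟩ := Multiset.exists_cons_of_mem hts'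
            exact ⟨w, fun x hx => hR x (hs x hx), ⟨rfl, rfl, rfl⟩, rfl⟩
          · refine canAbsorb_of_peelable hf hpeel.1 (hR t (by simp)) (fun x hx => hR x (hs x hx))
              (fun x hx => (List.mem_cons.1 (hs x hx)).resolve_left ?_) hts h
            rintro rfl
            exact hts' hx
        by_cases hts : t ∈ s
        · have hab := absorb s' s hs' h hts
          obtain ⟨w, rfl⟩ := Multiset.exists_cons_of_mem hts
          exact step t w s' hn (fun x hx => hR x (hs x hx)) h hab
        · by_cases hts' : t ∈ s'
          · have hab := absorb s s' hs h.symm hts'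
            obtain ⟨w, rfl⟩ := Multiset.exists_cons_of_mem hts'
            exact (step t w s (h.card_eq ▸ hn) (fun x hx => hR x (hs' x hx)) h.symm hab).symm
          · refine ihR hpeel.2 (fun x hx => hR x (by simp [hx])) s s' hn ?_ ?_ h
            · intro x hx
              refine (List.mem_cons.1 (hs x hx)).resolve_left ?_
              rintro rfl
              exact hts hx
            · intro x hx
              refine (List.mem_cons.1 (hs' x hx)).resolve_left ?_
              rintro rfl
              exact hts' hx
    intro s s' hn hs hs' h
    exact main T hp (fun t => (hT t).1) s s' hn (fun x hx => (hT x).2 (hs x hx))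
      (fun x hx => (hT x).2 (hs' x hx)) h

theorem level_le (a b c x : ℕ) : level a b c x ≤ 3 := by
  unfold level
  cases x == a <;> cases x == b <;> cases x == c <;> simp

theorem admissible_iff {a b c : ℕ} {t : ℕ × ℕ × ℕ} : admissible a b c t = true ↔
    t.1 < t.2.1 ∧ t.2.1 < 5 ∧ t.2.2 ≤ level a b c t.1 ∧ t.2.2 ≤ level a b c t.2.1 := by
  simp [admissible, Nat.blt_eq, and_assoc]

/-- The admissible triples, in an order in which they can be peeled off. -/
def triples (a b c : ℕ) : List (ℕ × ℕ × ℕ) := peelOrder.filter (admissible a b c)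

theorem mem_triples {a b c : ℕ} {t : ℕ × ℕ × ℕ} :
    t ∈ triples a b c ↔ admissible a b c t = true := by
  rw [triples, List.mem_filter]
  refine ⟨fun h => h.2, fun h => ⟨?_, h⟩⟩
  obtain ⟨h1, h2, h3, -⟩ := admissible_iff.1 h
  have h4 := h3.trans (level_le a b c t.1)
  obtain ⟨i, j, k⟩ := t
  dsimp only at *
  interval_cases j <;> interval_cases i <;> interval_cases k <;> simp [peelOrder]

theorem peels_check : positionTriples.all (fun x =>
    peelsAll x.1 x.2.1 x.2.2 (triples x.1 x.2.1 x.2.2)) = true := by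
  decide +kernel


theorem peelsAll_triples {a b c : ℕ} (h : (a, b, c) ∈ positionTriples) :
    peelsAll a b c (triples a b c) = true :=
  List.all_eq_true.1 peels_check _ h

/-- An injective encoding of a coordinate margin of size two. -/
def sidon (x : ℕ) : ℕ := bif x == 0 then 0 else bif x == 1 then 1 else bif x == 2 then 4 else 6

def weightCode (t : ℕ × ℕ × ℕ) : ℕ :=
  sidon t.1 + 13 * sidon (t.2.1 - 1) + 169 * sidon t.2.2

def unorderedPairs {α : Type*} : List α → List (α × α)
  | [] => []
  | p :: R => (p :: R).map (fun q => (p, q)) ++ unorderedPairs R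

/-- The elements of the list whose codes are not in the bit set `s`, one for each code. -/
def newCodes {α : Type*} (f : α → ℕ) : List α → ℕ → List α
  | [], _ => []
  | x :: l, s => bif s.testBit (f x) then newCodes f l s else x :: newCodes f l (s ||| 2 ^ f x)

def pairCode (x : (ℕ × ℕ × ℕ) × (ℕ × ℕ × ℕ)) : ℕ := weightCode x.1 + weightCode x.2

theorem newCodes_check : positionTriples.all (fun x => Nat.ble 175
    (newCodes pairCode (unorderedPairs (triples x.1 x.2.1 x.2.2)) 0).length) = true := by
  decide +kernel

theorem newCodes_subset {α : Type*} (f : α → ℕ) (l : List α) (s : ℕ) : newCodes f l s ⊆ l := by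
  induction l generalizing s with
  | nil => simp [newCodes]
  | cons x l ih =>
    rw [newCodes]
    cases s.testBit (f x)
    · exact List.cons_subset_cons _ (ih _)
    · exact fun y hy => List.mem_cons_of_mem _ (ih _ hy)

theorem testBit_newCodes {α : Type*} (f : α → ℕ) (l : List α) (s : ℕ) :
    ∀ x ∈ newCodes f l s, s.testBit (f x) = false := by
  induction l generalizing s with
  | nil => simp [newCodes]
  | cons x l ih =>
    rw [newCodes]
    cases h : s.testBit (f x)
    · intro y hy
      rcases List.mem_cons.1 hy with rfl | hy
      · exact h
      · have := ih _ y hy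
        rw [Nat.testBit_or, Bool.or_eq_false_iff] at this
        exact this.1
    · exact ih _

theorem nodup_newCodes {α : Type*} (f : α → ℕ) (l : List α) (s : ℕ) :
    (newCodes f l s).Pairwise fun x y => f x ≠ f y := by
  induction l generalizing s with
  | nil => simp [newCodes]
  | cons x l ih =>
    rw [newCodes]
    cases h : s.testBit (f x)
    · refine List.pairwise_cons.2 ⟨fun y hy e => ?_, ih _⟩
      have := testBit_newCodes f l _ y hy
      simp [e] at this
    · exact ih _

theorem mem_of_mem_unorderedPairs {α : Type*} {l : List α} {x : α × α}
    (h : x ∈ unorderedPairs l) : x.1 ∈ l ∧ x.2 ∈ l := by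
  induction l with
  | nil => simp [unorderedPairs] at h
  | cons p R ih =>
    rw [unorderedPairs, List.mem_append, List.mem_map] at h
    rcases h with ⟨q, hq, rfl⟩ | h
    · exact ⟨by simp, hq⟩
    · exact ⟨by simp [(ih h).1], by simp [(ih h).2]⟩

theorem SameMargins.pairCode_eq {x y : (ℕ × ℕ × ℕ) × (ℕ × ℕ × ℕ)}
    (h : SameMargins {x.1, x.2} {y.1, y.2}) : pairCode x = pairCode y := by
  obtain ⟨h1, h2, h3⟩ := h
  have e1 := congrArg (fun s => (s.map sidon).sum) h1
  have e2 := congrArg (fun s => (s.map fun n => sidon (n - 1)).sum) h2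
  have e3 := congrArg (fun s => (s.map sidon).sum) h3
  simp at e1 e2 e3
  simp only [pairCode, weightCode]
  omega

/-- There are at least `175` pairs of admissible triples with pairwise distinct margins. -/
theorem exists_margins {a b c : ℕ} (h : (a, b, c) ∈ positionTriples) :
    ∃ l : List ((ℕ × ℕ × ℕ) × (ℕ × ℕ × ℕ)), 175 ≤ l.length ∧
      (∀ x ∈ l, admissible a b c x.1 = true ∧ admissible a b c x.2 = true) ∧
      l.Pairwise fun x y => ¬ SameMargins {x.1, x.2} {y.1, y.2} := by
  refine ⟨newCodes pairCode (unorderedPairs (triples a b c)) 0, ?_, fun x hx => ?_, ?_⟩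
  · exact Nat.le_of_ble_eq_true (List.all_eq_true.1 newCodes_check _ h)
  · have := mem_of_mem_unorderedPairs (newCodes_subset _ _ _ hx)
    exact ⟨mem_triples.1 this.1, mem_triples.1 this.2⟩
  · exact (nodup_newCodes _ _ _).imp fun h h' => h h'.pairCode_eq

abbrev Exponent := (ℕ × ℕ) →₀ ℕ

theorem lexLT_cons {β : ℕ × ℕ} {L : List (ℕ × ℕ)} {a b : Exponent} :
    lexLT (β :: L) a b ↔ a β < b β ∨ (a β = b β ∧ lexLT L a b) := by
  constructor
  · rintro ⟨k, hk, h1, h2⟩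
    cases k with
    | zero => exact Or.inl (by simpa using h2)
    | succ k =>
      refine Or.inr ⟨by simpa using h1 0 (by simp), k, by simpa using hk, fun m hm => ?_,
        by simpa using h2⟩
      simpa using h1 (m + 1) (by omega)
  · rintro (h | ⟨h, k, hk, h1, h2⟩)
    · exact ⟨0, by simp, by simp, by simpa using h⟩
    · refine ⟨k + 1, by simpa using hk, fun m hm => ?_, by simpa using h2⟩
      cases m with
      | zero => simpa using h
      | succ m => simpa using h1 m (by omega)

theorem lexLT_iff {S : List (ℕ × ℕ)} {a b : Exponent} : lexLT S a b ↔ S.map a < S.map b := by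
  induction S with
  | nil => simp [lexLT]
  | cons β L ih => rw [lexLT_cons, List.map_cons, List.map_cons, List.cons_lt_cons_iff, ih]

theorem lexLE_iff {S : List (ℕ × ℕ)} {a b : Exponent} : lexLE S a b ↔ S.map a ≤ S.map b := by
  rw [lexLE, le_iff_lt_or_eq, ← lexLT_iff, List.map_inj_left, List.forall_mem_iff_getElem]
  refine or_congr Iff.rfl (forall_congr' fun k => forall_congr' fun hk => ?_)
  rw [List.getD_eq_getElem _ _ hk]

theorem lexLT_add {S : List (ℕ × ℕ)} {a b : Exponent} (c : Exponent) (h : lexLT S a b) :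
    lexLT S (c + a) (c + b) := by
  obtain ⟨k, hk, h1, h2⟩ := h
  exact ⟨k, hk, fun m hm => by rw [Finsupp.add_apply, Finsupp.add_apply, h1 m hm],
    by simpa using h2⟩

theorem Psi_eq_weight (d : Exponent) : Psi d = Finsupp.weight Ht d := by
  simp [Psi, Finsupp.weight_apply]

theorem Psi_add (a b : Exponent) : Psi (a + b) = Psi a + Psi b := by
  simp [Psi_eq_weight]

/-- The comparison `psiLT` between exponents of the same degree in the variable `(0,0)`. -/
def degLT (S : List (ℕ × ℕ)) (a b : Exponent) : Prop := a (0, 0) = b (0, 0) ∧ psiLT S a b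

theorem psiLT_iff {S : List (ℕ × ℕ)} {a b : Exponent} :
    psiLT S a b ↔ toLex (Psi a, OrderDual.toDual (S.map a)) <
      toLex (Psi b, OrderDual.toDual (S.map b)) := by
  rw [Prod.Lex.toLex_lt_toLex, psiLT, lexLT_iff]
  rfl

theorem psiLE_iff {S : List (ℕ × ℕ)} {a b : Exponent} :
    psiLE S a b ↔ toLex (Psi a, OrderDual.toDual (S.map a)) ≤
      toLex (Psi b, OrderDual.toDual (S.map b)) := by
  rw [Prod.Lex.toLex_le_toLex, psiLE, lexLE_iff]
  rfl

/-- Strict translation invariant orders on exponents. -/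
structure IsExponentOrder (r : Exponent → Exponent → Prop) : Prop where
  irrefl : ∀ a, ¬ r a a
  trans : ∀ a b c, r a b → r b c → r a c
  add : ∀ a b c, r a b → r (c + a) (c + b)

theorem isExponentOrder_degLT (S : List (ℕ × ℕ)) : IsExponentOrder (degLT S) where
  irrefl a := by simp [degLT, psiLT_iff]
  trans a b c h h' := by
    simp only [degLT, psiLT_iff] at *
    exact ⟨h.1.trans h'.1, h.2.trans h'.2⟩
  add a b c h := by
    refine ⟨by simp [h.1], ?_⟩
    rcases h.2 with h | ⟨h, h'⟩
    · left
      simpa [Psi_add] using h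
    · right
      exact ⟨by simp [Psi_add, h], lexLT_add c h'⟩

/-- `m` is the `r`-least exponent of `f`, with coefficient `ε`. -/
def Lead (r : Exponent → Exponent → Prop) (f : MvPolynomial (ℕ × ℕ) ℂ) (m : Exponent) (ε : ℂ) :
    Prop :=
  coeff m f = ε ∧ ∀ m' ∈ f.support, m' ≠ m → r m m'

theorem Lead.one (r : Exponent → Exponent → Prop) : Lead r 1 0 1 := by
  refine ⟨by simp, fun m' h h' => ?_⟩
  rw [mem_support_iff, coeff_one, if_neg h'.symm] at h
  exact absurd rfl h

theorem Lead.mul {r : Exponent → Exponent → Prop} (hr : IsExponentOrder r)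
    {f g : MvPolynomial (ℕ × ℕ) ℂ} {m n : Exponent} {ε δ : ℂ} (hf : Lead r f m ε)
    (hg : Lead r g n δ) : Lead r (f * g) (m + n) (ε * δ) := by
  have key : ∀ x ∈ f.support, ∀ y ∈ g.support, (x = m ∧ y = n) ∨ r (m + n) (x + y) := by
    intro x hx y hy
    by_cases h1 : x = m
    · by_cases h2 : y = n
      · exact Or.inl ⟨h1, h2⟩
      · subst h1
        exact Or.inr (hr.add _ _ _ (hg.2 y hy h2))
    · right
      have h3 : r (m + n) (x + n) := by
        rw [add_comm m, add_comm x]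
        exact hr.add _ _ _ (hf.2 x hx h1)
      by_cases h2 : y = n
      · subst h2
        exact h3
      · exact hr.trans _ _ _ h3 (hr.add _ _ _ (hg.2 y hy h2))
  constructor
  · rw [coeff_mul, Finset.sum_eq_single (m, n), hf.1, hg.1]
    · rintro ⟨x, y⟩ hxy hne
      by_contra h0
      have hx : x ∈ f.support := by
        rw [mem_support_iff]
        rintro h
        simp [h] at h0
      have hy : y ∈ g.support := by
        rw [mem_support_iff]
        rintro h
        simp [h] at h0
      rw [Finset.HasAntidiagonal.mem_antidiagonal] at hxy
      rcases key x hx y hy with ⟨rfl, rfl⟩ | h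
      · exact hne rfl
      · rw [show x + y = m + n from hxy] at h
        exact hr.irrefl _ h
    · intro h
      simp at h
  · intro z hz hne
    classical
    obtain ⟨x, hx, y, hy, rfl⟩ := Finset.mem_add.1 (support_mul f g hz)
    rcases key x hx y hy with ⟨rfl, rfl⟩ | h
    · exact absurd rfl hne
    · exact h

theorem Lead.neg {r : Exponent → Exponent → Prop} {f : MvPolynomial (ℕ × ℕ) ℂ} {m : Exponent}
    {ε : ℂ} (hf : Lead r f m ε) : Lead r (-f) m (-ε) :=
  ⟨by simp [hf.1], fun m' h => hf.2 m' (by simpa using h)⟩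

theorem Lead.pow {r : Exponent → Exponent → Prop} (hr : IsExponentOrder r)
    {f : MvPolynomial (ℕ × ℕ) ℂ} {m : Exponent} {ε : ℂ} (hf : Lead r f m ε) (k : ℕ) :
    Lead r (f ^ k) (k • m) (ε ^ k) := by
  induction k with
  | zero => simpa using Lead.one r
  | succ k ih =>
    rw [pow_succ, pow_succ, succ_nsmul]
    exact ih.mul hr hf

theorem Lead.prod {ι : Type*} {r : Exponent → Exponent → Prop} (hr : IsExponentOrder r)
    (s : Finset ι) {f : ι → MvPolynomial (ℕ × ℕ) ℂ} {m : ι → Exponent} {ε : ι → ℂ}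
    (h : ∀ i ∈ s, Lead r (f i) (m i) (ε i)) :
    Lead r (∏ i ∈ s, f i) (∑ i ∈ s, m i) (∏ i ∈ s, ε i) := by
  classical
  induction s using Finset.induction_on with
  | empty => simpa using Lead.one r
  | insert i s hi ih =>
    rw [Finset.prod_insert hi, Finset.prod_insert hi, Finset.sum_insert hi]
    exact (h i (by simp)).mul hr (ih fun j hj => h j (by simp [hj]))

/-- Leads for the order `lexLT` read backwards. -/
abbrev LexLead (S : List (ℕ × ℕ)) := Lead fun a b => lexLT S b a

/-- Polynomials in the variables listed in `L`. -/
noncomputable abbrev PolyIn (L : List (ℕ × ℕ)) : Subalgebra ℂ (MvPolynomial (ℕ × ℕ) ℂ) :=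
  supported ℂ {β | β ∈ L}

theorem eq_zero_of_mem_polyIn {L : List (ℕ × ℕ)} {f : MvPolynomial (ℕ × ℕ) ℂ} (hf : f ∈ PolyIn L)
    {m : Exponent} (hm : m ∈ f.support) {β : ℕ × ℕ} (hβ : β ∉ L) : m β = 0 := by
  by_contra h
  exact hβ (mem_supported.1 hf (by
    rw [Finset.mem_coe, mem_vars_iff_mem_support]
    exact ⟨m, hm, Finsupp.mem_support_iff.2 h⟩))

theorem LexLead.skip {L : List (ℕ × ℕ)} {β : ℕ × ℕ} {f : MvPolynomial (ℕ × ℕ) ℂ} {m : Exponent}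
    {ε : ℂ} (hf : LexLead L f m ε) (hε : ε ≠ 0) (hL : f ∈ PolyIn L) (hβ : β ∉ L) :
    LexLead (β :: L) f m ε := by
  refine ⟨hf.1, fun m' h h' => lexLT_cons.2 (Or.inr ⟨?_, hf.2 m' h h'⟩)⟩
  have hm : m ∈ f.support := by rwa [mem_support_iff, hf.1]
  rw [eq_zero_of_mem_polyIn hL h hβ, eq_zero_of_mem_polyIn hL hm hβ]

theorem LexLead.take {L : List (ℕ × ℕ)} {β : ℕ × ℕ} {f g : MvPolynomial (ℕ × ℕ) ℂ} {m : Exponent}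
    {ε : ℂ} (hf : LexLead L f m ε) (hε : ε ≠ 0) (hL : f ∈ PolyIn L) (hg : g ∈ PolyIn L)
    (hβ : β ∉ L) : LexLead (β :: L) (X β * f + g) (Finsupp.single β 1 + m) ε := by
  have hm : m ∈ f.support := by rwa [mem_support_iff, hf.1]
  have hmβ := eq_zero_of_mem_polyIn hL hm hβ
  have hg0 : ∀ m' ∈ g.support, m' β = 0 := fun m' h => eq_zero_of_mem_polyIn hg h hβ
  constructor
  · rw [coeff_add, coeff_X_mul, hf.1]
    have : Finsupp.single β 1 + m ∉ g.support := by
      intro h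
      have := hg0 _ h
      simp at this
    rw [notMem_support_iff.1 this, add_zero]
  · intro m' h h'
    classical
    rcases Finset.mem_union.1 (support_add h) with h | h
    · rw [support_X_mul, Finset.mem_map] at h
      obtain ⟨n, hn, rfl⟩ := h
      simp only [addLeftEmbedding_apply] at h' ⊢
      apply lexLT_add
      refine lexLT_cons.2 (Or.inr ⟨?_, hf.2 n hn ?_⟩)
      · rw [hmβ, eq_zero_of_mem_polyIn hL hn hβ]
      · rintro rfl
        exact h' rfl
    · refine lexLT_cons.2 (Or.inl ?_)
      rw [hg0 m' h]
      simp

theorem minSupp_eq {S : List (ℕ × ℕ)} {f : MvPolynomial (ℕ × ℕ) ℂ} {m : Exponent} {ε : ℂ}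
    (hf : LexLead S f m ε) (hε : ε ≠ 0) (hP : ∀ m' ∈ f.support, Psi m' = Psi m) :
    minSupp S f = m := by
  have hm : m ∈ f.support := by rwa [mem_support_iff, hf.1]
  have hex : ∃ m ∈ f.support, ∀ m' ∈ f.support, psiLE S m m' := by
    refine ⟨m, hm, fun m' h => Or.inr ⟨(hP m' h).symm, ?_⟩⟩
    by_cases h' : m' = m
    · subst h'
      exact Or.inr fun _ _ => rfl
    · exact Or.inl (hf.2 m' h h')
  rw [minSupp, dif_pos hex]
  obtain ⟨h1, h2⟩ := hex.choose_spec
  by_contra hne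
  have h3 : lexLT S hex.choose m := hf.2 _ h1 hne
  rcases h2 m hm with h | ⟨-, h⟩
  · rw [hP _ h1] at h
    exact lt_irrefl _ h
  · rw [lexLT_iff] at h3
    rw [lexLE_iff] at h
    exact absurd h3 (not_lt_of_ge h)

theorem ASmat_cons {n : ℕ} {β : ℕ × ℕ} {L : List (ℕ × ℕ)} {r c : ℕ} (hβ : 1 ≤ β.1 ∧ β.1 ≤ n)
    (hc : 1 ≤ c ∧ c ≤ n) :
    ASmat n (β :: L) r c = ASmat n L r c + if c = β.2 then ASmat n L r β.1 * X β else 0 := by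
  have h1 : β.1 ∈ Finset.Icc 1 n := Finset.mem_Icc.2 hβ
  have h2 : c ∈ Finset.Icc 1 n := Finset.mem_Icc.2 hc
  simp only [ASmat, matMul, factor, mul_add, Finset.sum_add_distrib, mul_ite, mul_one, mul_zero]
  rw [Finset.sum_ite_eq' _ c, if_pos h2]
  by_cases h : c = β.2
  · simp [h, hβ]
  · simp [h]

theorem ASmat_eq_idN {n : ℕ} {L : List (ℕ × ℕ)} {r c : ℕ} (hL : ∀ β ∈ L, 1 ≤ β.1 ∧ β.1 ≤ n)
    (hc : 1 ≤ c ∧ c ≤ n) (h : ∀ β ∈ L, c ≠ β.2) : ASmat n L r c = idN r c := by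
  induction L with
  | nil => rfl
  | cons β L ih =>
    rw [ASmat_cons (hL β (by simp)) hc, if_neg (h β (by simp)), add_zero,
      ih (fun β hβ => hL β (by simp [hβ])) fun β hβ => h β (by simp [hβ])]

theorem ASmat_mem_polyIn {n : ℕ} {L : List (ℕ × ℕ)} {r c : ℕ} : ASmat n L r c ∈ PolyIn L := by
  induction L generalizing c with
  | nil =>
    simp only [ASmat, idN]
    split_ifs
    · exact one_mem _
    · exact zero_mem _
  | cons β L ih =>
    have hle : PolyIn L ≤ PolyIn (β :: L) := supported_mono fun γ hγ => List.mem_cons_of_mem _ hγ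
    simp only [ASmat, matMul, factor]
    refine Subalgebra.sum_mem _ fun k _ => mul_mem (hle ih) (add_mem ?_ ?_)
    · split_ifs
      · exact one_mem _
      · exact zero_mem _
    · split_ifs
      · exact X_mem_supported.2 (by simp)
      · exact zero_mem _

/-- Entries of `A_S` are homogeneous for the height grading. -/
theorem ASmat_isWeightedHomogeneous {n : ℕ} {L : List (ℕ × ℕ)} (hL : ∀ β ∈ L, β.1 ≤ β.2)
    {r c : ℕ} :
    IsWeightedHomogeneous (fun β => (Ht β : ℤ)) (ASmat n L r c) ((c : ℤ) - r) := by
  induction L generalizing c with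
  | nil =>
    simp only [ASmat, idN]
    split_ifs with h
    · rw [h, sub_self]
      exact isWeightedHomogeneous_one _ _
    · exact isWeightedHomogeneous_zero _ _ _
  | cons β L ih =>
    have hβ : β.1 ≤ β.2 := hL β (by simp)
    replace ih := @ih fun β hβ => hL β (by simp [hβ])
    simp only [ASmat, matMul]
    refine IsWeightedHomogeneous.sum _ _ _ fun k _ => ?_
    have e : (c : ℤ) - r = (k - r) + (c - k) := by ring
    rw [e]
    refine ih.mul (IsWeightedHomogeneous.add ?_ ?_)
    · split_ifs with h
      · rw [h, sub_self]
        exact isWeightedHomogeneous_one _ _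
      · exact isWeightedHomogeneous_zero _ _ _
    · split_ifs with h
      · have : (c : ℤ) - k = Ht β := by
          rw [h.1, h.2, Ht, Nat.cast_sub hβ]
        rw [this]
        exact isWeightedHomogeneous_X _ _ _
      · exact isWeightedHomogeneous_zero _ _ _

/-- The minor of `A_S` on rows `(1,2,3)` and columns `(x,y,z)`. -/
noncomputable abbrev minor (S : List (ℕ × ℕ)) (x y z : ℕ) : MvPolynomial (ℕ × ℕ) ℂ :=
  phiStar 6 S ![x, y, z]

theorem minor_eq (S : List (ℕ × ℕ)) (x y z : ℕ) : minor S x y z =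
    ASmat 6 S 1 x * ASmat 6 S 2 y * ASmat 6 S 3 z - ASmat 6 S 1 x * ASmat 6 S 2 z * ASmat 6 S 3 y -
    ASmat 6 S 1 y * ASmat 6 S 2 x * ASmat 6 S 3 z + ASmat 6 S 1 y * ASmat 6 S 2 z * ASmat 6 S 3 x +
    ASmat 6 S 1 z * ASmat 6 S 2 x * ASmat 6 S 3 y -
    ASmat 6 S 1 z * ASmat 6 S 2 y * ASmat 6 S 3 x := by
  simp [minor, phiStar, Matrix.det_fin_three]

theorem phiStar_eq_minor (S : List (ℕ × ℕ)) (K : Fin 3 → ℕ) :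
    phiStar 6 S K = minor S (K 0) (K 1) (K 2) := by
  simp [minor, phiStar, Matrix.det_fin_three]

theorem minor_swap₁₂ (S : List (ℕ × ℕ)) (x y z : ℕ) : minor S y x z = -minor S x y z := by
  rw [minor_eq, minor_eq]
  ring

theorem minor_swap₂₃ (S : List (ℕ × ℕ)) (x y z : ℕ) : minor S x z y = -minor S x y z := by
  rw [minor_eq, minor_eq]
  ring

theorem minor_isWeightedHomogeneous {S : List (ℕ × ℕ)} (hS : ∀ β ∈ S, β.1 ≤ β.2) (x y z : ℕ) :
    IsWeightedHomogeneous (fun β => (Ht β : ℤ)) (minor S x y z) ((x : ℤ) + y + z - 6) := by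
  have h := @ASmat_isWeightedHomogeneous 6 S hS
  have key : ∀ u v w : ℕ, (u : ℤ) + v + w = x + y + z → IsWeightedHomogeneous
      (fun β => (Ht β : ℤ)) (ASmat 6 S 1 u * ASmat 6 S 2 v * ASmat 6 S 3 w)
      ((x : ℤ) + y + z - 6) := by
    intro u v w e
    have e' : (x : ℤ) + y + z - 6 = ((u : ℤ) - (1 : ℕ)) + (v - (2 : ℕ)) + (w - (3 : ℕ)) := by
      push_cast
      omega
    rw [e']
    exact (h.mul h).mul h
  rw [minor_eq]
  rw [← mem_weightedHomogeneousSubmodule]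
  refine sub_mem (add_mem (add_mem (sub_mem (sub_mem ?_ ?_) ?_) ?_) ?_) ?_ <;>
    exact key _ _ _ (by ring)

theorem Psi_eq_of_mem_support_minor {S : List (ℕ × ℕ)} (hS : ∀ β ∈ S, β.1 ≤ β.2) {x y z : ℕ}
    {m m' : Exponent} (hm : m ∈ (minor S x y z).support) (hm' : m' ∈ (minor S x y z).support) :
    Psi m = Psi m' := by
  have h := minor_isWeightedHomogeneous hS x y z
  have key : ∀ m ∈ (minor S x y z).support, (Psi m : ℤ) = (x : ℤ) + y + z - 6 := by
    intro m hm
    rw [← h (mem_support_iff.1 hm), Psi, Finsupp.weight_apply, Finsupp.sum, Finsupp.sum]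
    push_cast
    simp
  have := (key m hm).trans (key m' hm').symm
  exact_mod_cast this

theorem minor_mem_polyIn (S : List (ℕ × ℕ)) (x y z : ℕ) : minor S x y z ∈ PolyIn S := by
  have h : ∀ r c, ASmat 6 S r c ∈ PolyIn S := fun r c => ASmat_mem_polyIn
  rw [minor_eq]
  exact sub_mem (add_mem (add_mem (sub_mem (sub_mem
    (mul_mem (mul_mem (h _ _) (h _ _)) (h _ _)) (mul_mem (mul_mem (h _ _) (h _ _)) (h _ _)))
    (mul_mem (mul_mem (h _ _) (h _ _)) (h _ _))) (mul_mem (mul_mem (h _ _) (h _ _)) (h _ _)))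
    (mul_mem (mul_mem (h _ _) (h _ _)) (h _ _))) (mul_mem (mul_mem (h _ _) (h _ _)) (h _ _))

/-- The minor on columns `x,y,z` has lexicographic leading exponent `m`, with coefficient a
sign. -/
def HasLead (S : List (ℕ × ℕ)) (x y z : ℕ) (m : Exponent) : Prop :=
  ∃ ε : ℂ, (ε = 1 ∨ ε = -1) ∧ LexLead S (minor S x y z) m ε

theorem HasLead.swap₁₂ {S : List (ℕ × ℕ)} {x y z : ℕ} {m : Exponent} (h : HasLead S x y z m) :
    HasLead S y x z m := by
  obtain ⟨ε, hε, h⟩ := h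
  refine ⟨-ε, by rcases hε with rfl | rfl <;> simp, ?_⟩
  rw [minor_swap₁₂]
  exact h.neg

theorem HasLead.swap₂₃ {S : List (ℕ × ℕ)} {x y z : ℕ} {m : Exponent} (h : HasLead S x y z m) :
    HasLead S x z y m := by
  obtain ⟨ε, hε, h⟩ := h
  refine ⟨-ε, by rcases hε with rfl | rfl <;> simp, ?_⟩
  rw [minor_swap₂₃]
  exact h.neg

/-- The factors of one step of the iteration. -/
def extend (z i₁ i₂ i₃ : ℕ) (L : List (ℕ × ℕ)) : List (ℕ × ℕ) :=
  (i₁, z) :: (i₂, z) :: (i₃, z) :: L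

/-- The first of `i₁`, `i₂`, `i₃` which is not `x` or `y`. -/
def firstNot (i₁ i₂ i₃ x y : ℕ) : ℕ :=
  if i₁ ≠ x ∧ i₁ ≠ y then i₁ else if i₂ ≠ x ∧ i₂ ≠ y then i₂ else i₃

/-- The hypotheses of one step of the iteration. -/
structure Extends (z i₁ i₂ i₃ : ℕ) (L : List (ℕ × ℕ)) : Prop where
  fst : ∀ β ∈ L, 1 ≤ β.1 ∧ β.1 ≤ 6
  snd : ∀ β ∈ L, β.2 < z
  lt : i₁ < z ∧ i₂ < z ∧ i₃ < z
  pos : 1 ≤ i₁ ∧ 1 ≤ i₂ ∧ 1 ≤ i₃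
  four_le : 4 ≤ z
  le_six : z ≤ 6
  ne : i₁ ≠ i₂ ∧ i₁ ≠ i₃ ∧ i₂ ≠ i₃

section Step

variable {z i₁ i₂ i₃ : ℕ} {L : List (ℕ × ℕ)}

theorem Extends.ASmat_eq (h : Extends z i₁ i₂ i₃ L) {r c : ℕ} (hc : 1 ≤ c ∧ c < z) :
    ASmat 6 (extend z i₁ i₂ i₃ L) r c = ASmat 6 L r c := by
  obtain ⟨-, -, h3, h4, h5, h6, -⟩ := h
  have hc' : 1 ≤ c ∧ c ≤ 6 := by omega
  rw [extend, ASmat_cons (by dsimp only; omega) hc', ASmat_cons (by dsimp only; omega) hc',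
    ASmat_cons (by dsimp only; omega) hc']
  simp [hc.2.ne]

theorem Extends.ASmat_last (h : Extends z i₁ i₂ i₃ L) {r : ℕ} (hr : r ≤ 3) :
    ASmat 6 (extend z i₁ i₂ i₃ L) r z = ASmat 6 L r i₁ * X (i₁, z) + ASmat 6 L r i₂ * X (i₂, z) +
      ASmat 6 L r i₃ * X (i₃, z) := by
  obtain ⟨h1, h2, h3, h4, h5, h6, -⟩ := h
  have hz : 1 ≤ z ∧ z ≤ 6 := by omega
  have e : ASmat 6 L r z = 0 := by
    rw [ASmat_eq_idN h1 hz fun β hβ => (h2 β hβ).ne', idN, if_neg (by omega)]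
  rw [extend]
  have hlow : ∀ c, 1 ≤ c → c < z → ∀ i, 1 ≤ i → i < z → ∀ L',
      ASmat 6 ((i, z) :: L') r c = ASmat 6 L' r c := fun c hc hcz i hi hiz L' => by
    rw [ASmat_cons (by dsimp only; omega) (by omega), if_neg hcz.ne, add_zero]
  rw [ASmat_cons (by dsimp only; omega) hz, ASmat_cons (by dsimp only; omega) hz,
    ASmat_cons (by dsimp only; omega) hz, if_pos rfl, if_pos rfl, if_pos rfl, e]
  dsimp only
  rw [hlow i₁ h4.1 h3.1 i₂ h4.2.1 h3.2.1, hlow i₁ h4.1 h3.1 i₃ h4.2.2 h3.2.2,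
    hlow i₂ h4.2.1 h3.2.1 i₃ h4.2.2 h3.2.2]
  ring

theorem Extends.minor_eq (h : Extends z i₁ i₂ i₃ L) {x y w : ℕ} (hx : 1 ≤ x ∧ x < z)
    (hy : 1 ≤ y ∧ y < z) (hw : 1 ≤ w ∧ w < z) :
    minor (extend z i₁ i₂ i₃ L) x y w = minor L x y w := by
  simp only [Gr36.minor_eq, h.ASmat_eq hx, h.ASmat_eq hy, h.ASmat_eq hw]

theorem Extends.minor_last (h : Extends z i₁ i₂ i₃ L) {x y : ℕ} (hx : 1 ≤ x ∧ x < z)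
    (hy : 1 ≤ y ∧ y < z) : minor (extend z i₁ i₂ i₃ L) x y z =
      X (i₁, z) * minor L x y i₁ + (X (i₂, z) * minor L x y i₂ + X (i₃, z) * minor L x y i₃) := by
  simp only [Gr36.minor_eq, h.ASmat_eq hx, h.ASmat_eq hy, h.ASmat_last (r := 1) (by omega),
    h.ASmat_last (r := 2) (by omega), h.ASmat_last (r := 3) (by omega)]
  ring

theorem minor_eq_zero {S : List (ℕ × ℕ)} {x y w : ℕ} (h : ¬ (w ≠ x ∧ w ≠ y)) :
    minor S x y w = 0 := by
  rw [minor_eq]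
  rcases not_and_or.1 h with h | h <;> rw [not_not.1 h] <;> ring

theorem Extends.notMem (h : Extends z i₁ i₂ i₃ L) (i : ℕ) : (i, z) ∉ L := fun h' =>
  lt_irrefl _ (h.snd _ h')

theorem Extends.hasLead (h : Extends z i₁ i₂ i₃ L) {x y w : ℕ} (hx : 1 ≤ x ∧ x < z)
    (hy : 1 ≤ y ∧ y < z) (hw : 1 ≤ w ∧ w < z) {m : Exponent} (hm : HasLead L x y w m) :
    HasLead (extend z i₁ i₂ i₃ L) x y w m := by
  obtain ⟨ε, hε, hm⟩ := hm
  refine ⟨ε, hε, ?_⟩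
  have hε0 : ε ≠ 0 := by rcases hε with rfl | rfl <;> simp
  rw [h.minor_eq hx hy hw]
  have hP := minor_mem_polyIn L x y w
  have m1 : PolyIn L ≤ PolyIn ((i₃, z) :: L) := supported_mono fun γ hγ => by
    exact List.mem_cons_of_mem _ hγ
  have m2 : PolyIn ((i₃, z) :: L) ≤ PolyIn ((i₂, z) :: (i₃, z) :: L) :=
    supported_mono fun γ hγ => List.mem_cons_of_mem _ hγ
  have n2 : (i₂, z) ∉ (i₃, z) :: L := by simp [h.notMem, h.ne.2.2]
  have n1 : (i₁, z) ∉ (i₂, z) :: (i₃, z) :: L := by simp [h.notMem, h.ne.1, h.ne.2.1]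
  exact ((hm.skip hε0 hP (h.notMem _)).skip hε0 (m1 hP) n2).skip hε0 (m2 (m1 hP)) n1

theorem Extends.hasLead_last (h : Extends z i₁ i₂ i₃ L) {x y : ℕ} (hx : 1 ≤ x ∧ x < z)
    (hy : 1 ≤ y ∧ y < z) {m : Exponent} (hm : HasLead L x y (firstNot i₁ i₂ i₃ x y) m) :
    HasLead (extend z i₁ i₂ i₃ L) x y z (Finsupp.single (firstNot i₁ i₂ i₃ x y, z) 1 + m) := by
  obtain ⟨ε, hε, hm⟩ := hm
  refine ⟨ε, hε, ?_⟩
  have hε0 : ε ≠ 0 := by rcases hε with rfl | rfl <;> simp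
  rw [h.minor_last hx hy]
  have hP := minor_mem_polyIn L x y
  have m1 : PolyIn L ≤ PolyIn ((i₃, z) :: L) :=
    supported_mono fun γ hγ => List.mem_cons_of_mem _ hγ
  have m2 : PolyIn ((i₃, z) :: L) ≤ PolyIn ((i₂, z) :: (i₃, z) :: L) :=
    supported_mono fun γ hγ => List.mem_cons_of_mem _ hγ
  have n3 : (i₃, z) ∉ L := h.notMem _
  have n2 : (i₂, z) ∉ (i₃, z) :: L := by simp [h.notMem, h.ne.2.2]
  have n1 : (i₁, z) ∉ (i₂, z) :: (i₃, z) :: L := by simp [h.notMem, h.ne.1, h.ne.2.1]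
  have x3 : (X (i₃, z) : MvPolynomial (ℕ × ℕ) ℂ) ∈ PolyIn ((i₃, z) :: L) :=
    X_mem_supported.2 (by simp)
  have x2 : (X (i₂, z) : MvPolynomial (ℕ × ℕ) ℂ) ∈ PolyIn ((i₂, z) :: (i₃, z) :: L) :=
    X_mem_supported.2 (by simp)
  have g3 : X (i₃, z) * minor L x y i₃ ∈ PolyIn ((i₃, z) :: L) := mul_mem x3 (m1 (hP _))
  have g2 : X (i₂, z) * minor L x y i₂ + X (i₃, z) * minor L x y i₃ ∈
      PolyIn ((i₂, z) :: (i₃, z) :: L) := add_mem (mul_mem x2 (m2 (m1 (hP _)))) (m2 g3)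
  unfold firstNot at hm ⊢
  split_ifs at hm ⊢ with h1 h2
  · exact ((hm.skip hε0 (hP _) n3).skip hε0 (m1 (hP _)) n2).take hε0 (m2 (m1 (hP _))) g2 n1
  · rw [minor_eq_zero h1, mul_zero, zero_add]
    exact (hm.skip hε0 (hP _) n3 |>.take hε0 (m1 (hP _)) g3 n2).skip hε0 g2 n1
  · rw [minor_eq_zero h1, minor_eq_zero h2, mul_zero, zero_add, mul_zero, zero_add]
    have := hm.take hε0 (hP _) (zero_mem (PolyIn L)) n3
    rw [add_zero] at this
    exact (this.skip hε0 g3 n2).skip hε0 (m2 g3) n1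

end Step

theorem ASmat_nil (r c : ℕ) : ASmat 6 [] r c = if r = c then 1 else 0 := rfl

theorem hasLead_nil {x y z : ℕ} (h : [1, 2, 3].Perm [x, y, z]) : HasLead [] x y z 0 := by
  have h0 : HasLead [] 1 2 3 0 := by
    refine ⟨1, Or.inl rfl, ?_⟩
    have : minor [] 1 2 3 = 1 := by
      rw [minor_eq]
      simp [ASmat_nil]
    rw [this]
    exact Lead.one _
  have hx : ∀ t ∈ [x, y, z], t ∈ [1, 2, 3] := fun t ht => h.symm.subset ht
  have hn : [x, y, z].Nodup := h.nodup (by decide)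
  rw [List.forall_mem_cons, List.forall_mem_cons, List.forall_mem_cons] at hx
  simp only [List.mem_cons, List.not_mem_nil, or_false] at hx
  obtain ⟨rfl | rfl | rfl, rfl | rfl | rfl, rfl | rfl | rfl, -⟩ := hx
  all_goals try exact absurd hn (by decide)
  · exact h0
  · exact h0.swap₂₃
  · exact h0.swap₁₂
  · exact h0.swap₁₂.swap₂₃
  · exact h0.swap₂₃.swap₁₂
  · exact h0.swap₁₂.swap₂₃.swap₁₂

theorem perm_of_distinct {x y z : ℕ} (hx : 1 ≤ x ∧ x ≤ 3) (hy : 1 ≤ y ∧ y ≤ 3)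
    (hz : 1 ≤ z ∧ z ≤ 3) (h1 : x ≠ y) (h2 : x ≠ z) (h3 : y ≠ z) : [1, 2, 3].Perm [x, y, z] := by
  refine ((List.subperm_of_subset (by simp [h1, h2, h3]) ?_).perm_of_length_le (by simp)).symm
  intro t ht
  simp at ht ⊢
  omega

/-- The contribution to exponents of the missing column `w` among the first four. -/
noncomputable def wt₄ (w : ℕ) : Exponent := if w = 4 then 0 else Finsupp.single (w, 4) 1

theorem firstNot_eq {i₁ i₂ i₃ x y w : ℕ} (hx : w ≠ x) (hy : w ≠ y)
    (h : (w = i₁) ∨ (w = i₂ ∧ (i₁ = x ∨ i₁ = y)) ∨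
      (w = i₃ ∧ (i₁ = x ∨ i₁ = y) ∧ (i₂ = x ∨ i₂ = y))) :
    firstNot i₁ i₂ i₃ x y = w := by
  unfold firstNot
  split_ifs <;> omega

/-- Labels of the positions `0, …, 4`, and the orders of the first factors. -/
structure Labelling (lab : ℕ → ℕ) (L : List (ℕ × ℕ)) : Prop where
  zero : lab 0 = 5
  pos : ∀ p, 1 ≤ p → p < 5 → 1 ≤ lab p ∧ lab p ≤ 4
  inj : ∀ p q, p < 5 → q < 5 → lab p = lab q → p = q
  base : L.Perm [(1,4),(2,4),(3,4)]

theorem exists_eq_extend {L : List (ℕ × ℕ)} (h : L.Perm [(1,4),(2,4),(3,4)]) :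
    ∃ x y z, L = extend 4 x y z [] ∧ [1, 2, 3].Perm [x, y, z] := by
  have hl := h.length_eq
  match L, hl with
  | [(x, x'), (y, y'), (z, z')], _ =>
    have hs : ∀ β ∈ [(x, x'), (y, y'), (z, z')], β.2 = 4 := fun β hβ => by
      have := h.subset hβ
      simp at this
      rcases this with rfl | rfl | rfl <;> rfl
    simp at hs
    obtain ⟨rfl, rfl, rfl⟩ := hs
    exact ⟨x, y, z, rfl, (h.map Prod.fst).symm⟩

theorem extends_base {x y z : ℕ} (h : [1, 2, 3].Perm [x, y, z]) : Extends 4 x y z [] := by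
  have hx : ∀ t ∈ [x, y, z], t ∈ [1, 2, 3] := fun t ht => h.symm.subset ht
  have hn : [x, y, z].Nodup := h.nodup (by decide)
  simp at hx hn
  constructor <;> (try simp) <;> omega

section Levels

variable {lab : ℕ → ℕ} {L : List (ℕ × ℕ)}

theorem hasLead₄ (hL : L.Perm [(1,4),(2,4),(3,4)]) {x y z w : ℕ} (hx : 1 ≤ x ∧ x ≤ 4)
    (hy : 1 ≤ y ∧ y ≤ 4) (hz : 1 ≤ z ∧ z ≤ 4) (hw : 1 ≤ w ∧ w ≤ 4)
    (hn : [x, y, z, w].Nodup) : HasLead L x y z (wt₄ w) := by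
  obtain ⟨a, b, c, rfl, hp⟩ := exists_eq_extend hL
  have hE := extends_base hp
  have key : ∀ x y, (1 ≤ x ∧ x ≤ 3) → (1 ≤ y ∧ y ≤ 3) → (1 ≤ w ∧ w ≤ 3) →
      x ≠ y → x ≠ w → y ≠ w → HasLead (extend 4 a b c []) x y 4 (wt₄ w) := by
    intro x y hx hy hw h1 h2 h3
    have hf : firstNot a b c x y = w := by
      have e1 := hE.pos
      have e2 := hE.lt
      have e3 := hE.ne
      apply firstNot_eq <;> omega
    have := hE.hasLead_last (x := x) (y := y) (m := 0) (by omega) (by omega)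
      (hasLead_nil (by rw [hf]; exact perm_of_distinct hx hy hw h1 h2 h3))
    rw [hf, add_zero] at this
    rwa [wt₄, if_neg (by omega)]
  simp at hn
  by_cases h4 : w = 4
  · rw [wt₄, if_pos h4]
    exact hE.hasLead (by omega) (by omega) (by omega)
      (hasLead_nil (perm_of_distinct (by omega) (by omega) (by omega) hn.1.1 hn.1.2.1 hn.2.1.1))
  · by_cases hx4 : x = 4
    · subst hx4
      exact (key y z (by omega) (by omega) (by omega) (by omega) (by omega)
        (by omega)).swap₂₃.swap₁₂
    · by_cases hy4 : y = 4
      · subst hy4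
        exact (key x z (by omega) (by omega) (by omega) (by omega) (by omega) (by omega)).swap₂₃
      · obtain rfl : z = 4 := by omega
        exact key x y (by omega) (by omega) (by omega) (by omega) (by omega) (by omega)

theorem extends_five (h : Labelling lab L) : Extends 5 (lab 1) (lab 2) (lab 3) L where
  fst β hβ := by
    have := h.base.subset hβ
    simp at this
    rcases this with rfl | rfl | rfl <;> simp
  snd β hβ := by
    have := h.base.subset hβ
    simp at this
    rcases this with rfl | rfl | rfl <;> simp
  lt := ⟨by linarith [h.pos 1 (by omega) (by omega)], by linarith [h.pos 2 (by omega) (by omega)],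
    by linarith [h.pos 3 (by omega) (by omega)]⟩
  pos := ⟨(h.pos 1 (by omega) (by omega)).1, (h.pos 2 (by omega) (by omega)).1,
    (h.pos 3 (by omega) (by omega)).1⟩
  four_le := by norm_num
  le_six := by norm_num
  ne := ⟨fun e => by have := h.inj 1 2 (by omega) (by omega) e; omega,
    fun e => by have := h.inj 1 3 (by omega) (by omega) e; omega,
    fun e => by have := h.inj 2 3 (by omega) (by omega) e; omega⟩

/-- The contribution to exponents of the smallest missing position. -/
noncomputable def wt₅ (lab : ℕ → ℕ) (i : ℕ) : Exponent :=
  if i = 0 then 0 else Finsupp.single (lab i, 5) 1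

theorem Labelling.ne (h : Labelling lab L) {p q : ℕ} (hp : p < 5) (hq : q < 5) (hpq : p ≠ q) :
    lab p ≠ lab q := fun e => hpq (h.inj p q hp hq e)

theorem hasLead₅ (h : Labelling lab L) {i j p q r : ℕ} (hij : i < j) (hj : j < 5) (hp : p < 5)
    (hq : q < 5) (hr : r < 5) (hn : [p, q, r, i, j].Nodup) :
    HasLead (extend 5 (lab 1) (lab 2) (lab 3) L) (lab p) (lab q) (lab r)
      (wt₅ lab i + wt₄ (lab j)) := by
  have hE := extends_five h
  simp only [List.nodup_cons, List.mem_cons, List.not_mem_nil, or_false, not_or] at hn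
  obtain ⟨⟨n1, n2, n3, n4⟩, ⟨n5, n6, n7⟩, ⟨n8, n9⟩, n10, -⟩ := hn
  by_cases hi : i = 0
  · subst hi
    have bp := h.pos p (by omega) hp
    have bq := h.pos q (by omega) hq
    have br := h.pos r (by omega) hr
    have bj := h.pos j (by omega) hj
    rw [wt₅, if_pos rfl, zero_add]
    refine hE.hasLead (by omega) (by omega) (by omega) (hasLead₄ h.base bp bq br bj ?_)
    simp [h.ne hp hq n1, h.ne hp hr n2, h.ne hp hj n4, h.ne hq hr n5, h.ne hq hj n7,
      h.ne hr hj n9]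
  · have key : ∀ p q, 1 ≤ p → 1 ≤ q → p < 5 → q < 5 → [p, q, i, j].Nodup →
        HasLead (extend 5 (lab 1) (lab 2) (lab 3) L) (lab p) (lab q) (lab 0)
          (wt₅ lab i + wt₄ (lab j)) := by
      intro p q hp1 hq1 hp hq hn
      simp only [List.nodup_cons, List.mem_cons, List.not_mem_nil, or_false, not_or] at hn
      obtain ⟨⟨n1, n2, n3⟩, ⟨n4, n5⟩, -, -⟩ := hn
      have bp := h.pos p hp1 hp
      have bq := h.pos q hq1 hq
      have bi := h.pos i (by omega) (by omega)
      have bj := h.pos j (by omega) hj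
      have hf : firstNot (lab 1) (lab 2) (lab 3) (lab p) (lab q) = lab i := by
        have hpi := h.ne (p := i) (q := p) (by omega) hp (by omega)
        have hqi := h.ne (p := i) (q := q) (by omega) hq (by omega)
        refine firstNot_eq hpi hqi ?_
        obtain e | e | e : i = 1 ∨ (i = 2 ∧ (1 = p ∨ 1 = q)) ∨
          (i = 3 ∧ (1 = p ∨ 1 = q) ∧ (2 = p ∨ 2 = q)) := by omega
        · exact Or.inl (by rw [e])
        · exact Or.inr (Or.inl ⟨by rw [e.1], e.2.imp (congrArg lab) (congrArg lab)⟩)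
        · exact Or.inr (Or.inr ⟨by rw [e.1], e.2.1.imp (congrArg lab) (congrArg lab),
            e.2.2.imp (congrArg lab) (congrArg lab)⟩)
      rw [h.zero, wt₅, if_neg hi, ← hf]
      refine hE.hasLead_last (by omega) (by omega) ?_
      rw [hf]
      refine hasLead₄ h.base bp bq bi bj ?_
      simp [h.ne hp hq n1, h.ne (q := i) hp (by omega) n2, h.ne hp hj n3,
        h.ne (q := i) hq (by omega) n4, h.ne hq hj n5, h.ne (p := i) (by omega) hj n10]
    by_cases h0 : p = 0
    · subst h0
      exact (key q r (by omega) (by omega) hq hr (by simp; omega)).swap₂₃.swap₁₂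
    · by_cases h0' : q = 0
      · subst h0'
        exact (key p r (by omega) (by omega) hp hr (by simp; omega)).swap₂₃
      · obtain rfl : r = 0 := by omega
        exact key p q (by omega) (by omega) hp hq (by simp; omega)

variable {a b c : ℕ}

/-- The positions of the three columns used in the last step. -/
structure Positions (a b c : ℕ) : Prop where
  lt : a < 5 ∧ b < 5 ∧ c < 5
  ne : a ≠ b ∧ a ≠ c ∧ b ≠ c

/-- The position of the `k`-th column used in the last step. -/
def place (a b c k : ℕ) : ℕ := if k = 1 then a else if k = 2 then b else c

theorem exists_complement {i j : ℕ} (hij : i < j) (hj : j < 5) :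
    ∃ p q r, p < 5 ∧ q < 5 ∧ r < 5 ∧ [p, q, r, i, j].Nodup ∧
      ∀ x < 5, x ≠ i → x ≠ j → x = p ∨ x = q ∨ x = r := by
  have : ∀ j < 5, ∀ i < j, ∃ p < 5, ∃ q < 5, ∃ r < 5, [p, q, r, i, j].Nodup ∧
      List.range 5 ⊆ [p, q, r, i, j] := by decide
  obtain ⟨p, hp, q, hq, r, hr, h, h'⟩ := this j hj i hij
  refine ⟨p, q, r, hp, hq, hr, h, fun x hx hi hj => ?_⟩
  have := h' (List.mem_range.2 hx)
  simpa [hi, hj] using this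

theorem exists_complement_of_place (ha : Positions a b c) {i j k : ℕ} (hij : i < j) (hj : j < 5)
    (hk : k ≠ 0) (hki : k ≤ level a b c i) (hkj : k ≤ level a b c j) :
    ∃ p q, p < 5 ∧ q < 5 ∧ [p, q, place a b c k, i, j].Nodup ∧
      (k = 1 ∨ (k = 2 ∧ (a = p ∨ a = q)) ∨ (k = 3 ∧ (a = p ∨ a = q) ∧ (b = p ∨ b = q))) := by
  have key : ∀ a b c j i : Fin 5, ∀ k : Fin 4,
      (a.1 ≠ b ∧ a.1 ≠ c ∧ b.1 ≠ c ∧ i.1 < j ∧ k.1 ≠ 0 ∧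
        k.1 ≤ level a b c i ∧ k.1 ≤ level a b c j) →
      ∃ p q : Fin 5, [p.1, q, place a b c k, i, j].Nodup ∧
        (k.1 = 1 ∨ (k.1 = 2 ∧ (a.1 = p ∨ a.1 = q)) ∨
          (k.1 = 3 ∧ (a.1 = p ∨ a.1 = q) ∧ (b.1 = p ∨ b.1 = q))) := by
    decide +kernel
  obtain ⟨p, q, h⟩ := key ⟨a, ha.lt.1⟩ ⟨b, ha.lt.2.1⟩ ⟨c, ha.lt.2.2⟩ ⟨j, hj⟩ ⟨i, hij.trans hj⟩
    ⟨k, Nat.lt_succ_of_le (hki.trans (level_le a b c i))⟩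
    ⟨ha.ne.1, ha.ne.2.1, ha.ne.2.2, hij, hk, hki, hkj⟩
  exact ⟨p, q, p.2, q.2, h⟩

/-- The contribution to exponents of the last step. -/
noncomputable def wt₆ (lab : ℕ → ℕ) (a b c k : ℕ) : Exponent :=
  if k = 0 then 0 else Finsupp.single (lab (place a b c k), 6) 1

theorem Labelling.bound (h : Labelling lab L) {p : ℕ} (hp : p < 5) : 1 ≤ lab p ∧ lab p ≤ 5 := by
  rcases Nat.eq_zero_or_pos p with rfl | h0
  · simp [h.zero]
  · have := h.pos p h0 hp
    omega

/-- The sequence with given positions. -/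
def seq (lab : ℕ → ℕ) (L : List (ℕ × ℕ)) (a b c : ℕ) : List (ℕ × ℕ) :=
  extend 6 (lab a) (lab b) (lab c) (extend 5 (lab 1) (lab 2) (lab 3) L)

theorem extends_six (h : Labelling lab L) (ha : Positions a b c) :
    Extends 6 (lab a) (lab b) (lab c) (extend 5 (lab 1) (lab 2) (lab 3) L) := by
  have h5 := extends_five h
  have p5 := h5.pos
  have l5 := h5.lt
  have ba := h.bound ha.lt.1
  have bb := h.bound ha.lt.2.1
  have bc := h.bound ha.lt.2.2
  refine ⟨fun β hβ => ?_, fun β hβ => ?_, by omega, by omega, by norm_num, by norm_num,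
    h.ne ha.lt.1 ha.lt.2.1 ha.ne.1, h.ne ha.lt.1 ha.lt.2.2 ha.ne.2.1,
    h.ne ha.lt.2.1 ha.lt.2.2 ha.ne.2.2⟩
  · simp only [extend, List.mem_cons] at hβ
    rcases hβ with rfl | rfl | rfl | hβ
    · dsimp only; omega
    · dsimp only; omega
    · dsimp only; omega
    · exact h5.fst β hβ
  · simp only [extend, List.mem_cons] at hβ
    rcases hβ with rfl | rfl | rfl | hβ
    · norm_num
    · norm_num
    · norm_num
    · exact (h5.snd β hβ).trans (by norm_num)

theorem exists_hasLead (h : Labelling lab L) (ha : Positions a b c) {t : ℕ × ℕ × ℕ}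
    (ht : admissible a b c t = true) : ∃ x y z, (1 ≤ x ∧ x ≤ 6) ∧ (1 ≤ y ∧ y ≤ 6) ∧
      (1 ≤ z ∧ z ≤ 6) ∧ [x, y, z].Nodup ∧ HasLead (seq lab L a b c) x y z
        (wt₆ lab a b c t.2.2 + (wt₅ lab t.1 + wt₄ (lab t.2.1))) := by
  have hE := extends_six h ha
  obtain ⟨i, j, k⟩ := t
  obtain ⟨hij, hj, hki, hkj⟩ := admissible_iff.1 ht
  dsimp only at *
  by_cases hk : k = 0
  · obtain ⟨p, q, r, hp, hq, hr, hn, -⟩ := exists_complement hij hj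
    have bp := h.bound hp
    have bq := h.bound hq
    have br := h.bound hr
    refine ⟨lab p, lab q, lab r, by omega, by omega, by omega, ?_, ?_⟩
    · simp at hn
      simp [h.ne hp hq (by omega), h.ne hp hr (by omega), h.ne hq hr (by omega)]
    · rw [hk, wt₆, if_pos rfl, zero_add]
      exact hE.hasLead (by omega) (by omega) (by omega) (hasLead₅ h hij hj hp hq hr hn)
  · obtain ⟨p, q, hp, hq, hn, hf⟩ : ∃ p q, p < 5 ∧ q < 5 ∧
        [p, q, place a b c k, i, j].Nodup ∧
        (k = 1 ∨ (k = 2 ∧ (a = p ∨ a = q)) ∨ (k = 3 ∧ (a = p ∨ a = q) ∧ (b = p ∨ b = q))) :=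
      exists_complement_of_place ha hij hj hk hki hkj
    have hr : place a b c k < 5 := by
      have := ha.lt
      unfold place
      split_ifs <;> omega
    have bp := h.bound hp
    have bq := h.bound hq
    have hL := hasLead₅ h hij hj hp hq hr hn
    simp at hn
    have hf' : firstNot (lab a) (lab b) (lab c) (lab p) (lab q) = lab (place a b c k) := by
      refine firstNot_eq (h.ne hr hp (by omega)) (h.ne hr hq (by omega)) ?_
      rcases hf with e | ⟨e, e1⟩ | ⟨e, e1, e2⟩
      · exact Or.inl (by simp [place, e])
      · exact Or.inr (Or.inl ⟨by simp [place, e], e1.imp (congrArg lab) (congrArg lab)⟩)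
      · exact Or.inr (Or.inr ⟨by simp [place, e], e1.imp (congrArg lab) (congrArg lab),
          e2.imp (congrArg lab) (congrArg lab)⟩)
    refine ⟨lab p, lab q, 6, by omega, by omega, by omega, ?_, ?_⟩
    · simp [h.ne hp hq (by omega)]
      omega
    · rw [wt₆, if_neg hk, ← hf']
      refine hE.hasLead_last (by omega) (by omega) ?_
      rwa [hf']

end Levels

section Margins

variable {lab : ℕ → ℕ} {L : List (ℕ × ℕ)} {a b c : ℕ}

/-- The exponent attached to a triple. -/
noncomputable def wt (lab : ℕ → ℕ) (a b c : ℕ) (t : ℕ × ℕ × ℕ) : Exponent :=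
  wt₆ lab a b c t.2.2 + (wt₅ lab t.1 + wt₄ (lab t.2.1))

theorem sum_map_apply_eq_count {α : Type*} {w : α → Exponent} {g : α → ℕ} {β : ℕ × ℕ} {x : ℕ}
    {s : Multiset α} (h : ∀ t ∈ s, w t β = if g t = x then 1 else 0) :
    (s.map w).sum β = (s.map g).count x := by
  induction s using Multiset.induction with
  | empty => simp
  | cons t s ih =>
    rw [Multiset.map_cons, Multiset.sum_cons, Finsupp.add_apply, Multiset.map_cons,
      Multiset.count_cons, ih fun u hu => h u (Multiset.mem_cons_of_mem hu),
      h t (Multiset.mem_cons_self t s), add_comm]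
    simp [eq_comm]

theorem eq_of_counts {u v : Multiset ℕ} (F : Finset ℕ) (x₀ : ℕ) (hu : ∀ x ∈ u, x ∈ F)
    (hv : ∀ x ∈ v, x ∈ F) (hc : u.card = v.card)
    (h : ∀ x ∈ F, x ≠ x₀ → u.count x = v.count x) : u = v := by
  have h' : ∀ x, x ≠ x₀ → u.count x = v.count x := fun x hx => by
    by_cases hF : x ∈ F
    · exact h x hF hx
    · rw [Multiset.count_eq_zero_of_notMem fun h => hF (hu x h),
        Multiset.count_eq_zero_of_notMem fun h => hF (hv x h)]
  ext x
  by_cases hx : x = x₀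
  · subst hx
    by_cases hF : x ∈ F
    · have e1 := Multiset.sum_count_eq_card hu
      have e2 := Multiset.sum_count_eq_card hv
      rw [← Finset.add_sum_erase F _ hF] at e1 e2
      have e3 : ∑ y ∈ F.erase x, u.count y = ∑ y ∈ F.erase x, v.count y :=
        Finset.sum_congr rfl fun y hy => h' y (Finset.ne_of_mem_erase hy)
      omega
    · rw [Multiset.count_eq_zero_of_notMem fun h => hF (hu x h),
        Multiset.count_eq_zero_of_notMem fun h => hF (hv x h)]
  · exact h' x hx

theorem Positions.place_inj (ha : Positions a b c) {k l : ℕ} (hk : 1 ≤ k ∧ k ≤ 3)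
    (hl : 1 ≤ l ∧ l ≤ 3) (h : place a b c k = place a b c l) : k = l := by
  have := ha.ne
  unfold place at h
  split_ifs at h <;> omega

theorem Positions.place_lt (ha : Positions a b c) (k : ℕ) : place a b c k < 5 := by
  have := ha.lt
  unfold place
  split_ifs <;> omega

theorem wt_apply_six (h : Labelling lab L) (ha : Positions a b c) {t : ℕ × ℕ × ℕ}
    (ht : admissible a b c t = true) {k : ℕ} (hk : 1 ≤ k ∧ k ≤ 3) :
    wt lab a b c t (lab (place a b c k), 6) = if t.2.2 = k then 1 else 0 := by
  have hk' := (admissible_iff.1 ht).2.2.1.trans (level_le a b c t.1)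
  have h5 : wt₅ lab t.1 (lab (place a b c k), 6) = 0 := by
    rw [wt₅]
    split_ifs <;> simp
  have h4 : wt₄ (lab t.2.1) (lab (place a b c k), 6) = 0 := by
    rw [wt₄]
    split_ifs <;> simp
  rw [wt, Finsupp.add_apply, Finsupp.add_apply, h4, h5, add_zero, add_zero, wt₆]
  by_cases h0 : t.2.2 = 0
  · rw [if_pos h0, if_neg (by omega)]
    rfl
  · rw [if_neg h0, Finsupp.single_apply]
    refine if_congr ⟨fun e => ?_, fun e => by rw [e]⟩ rfl rfl
    exact ha.place_inj (by omega) hk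
      (h.inj _ _ (ha.place_lt _) (ha.place_lt _) (Prod.ext_iff.1 e).1)

theorem wt_apply_five (h : Labelling lab L) {t : ℕ × ℕ × ℕ}
    (ht : admissible a b c t = true) {i : ℕ} (hi : 1 ≤ i ∧ i ≤ 3) :
    wt lab a b c t (lab i, 5) = if t.1 = i then 1 else 0 := by
  have hij := (admissible_iff.1 ht).1
  have hj := (admissible_iff.1 ht).2.1
  have h6 : wt₆ lab a b c t.2.2 (lab i, 5) = 0 := by
    rw [wt₆]
    split_ifs <;> simp
  have h4 : wt₄ (lab t.2.1) (lab i, 5) = 0 := by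
    rw [wt₄]
    split_ifs <;> simp
  rw [wt, Finsupp.add_apply, Finsupp.add_apply, h4, h6, zero_add, add_zero, wt₅]
  by_cases h0 : t.1 = 0
  · rw [if_pos h0, if_neg (by omega)]
    rfl
  · rw [if_neg h0, Finsupp.single_apply]
    refine if_congr ⟨fun e => ?_, fun e => by rw [e]⟩ rfl rfl
    exact h.inj _ _ (by omega) (by omega) (Prod.ext_iff.1 e).1

theorem wt_apply_four (h : Labelling lab L) {t : ℕ × ℕ × ℕ}
    (ht : admissible a b c t = true) {j : ℕ} (hj : 1 ≤ j ∧ j ≤ 4) (hj4 : lab j ≠ 4) :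
    wt lab a b c t (lab j, 4) = if t.2.1 = j then 1 else 0 := by
  have hij := (admissible_iff.1 ht).1
  have htj := (admissible_iff.1 ht).2.1
  have h6 : wt₆ lab a b c t.2.2 (lab j, 4) = 0 := by
    rw [wt₆]
    split_ifs <;> simp
  have h5 : wt₅ lab t.1 (lab j, 4) = 0 := by
    rw [wt₅]
    split_ifs <;> simp
  rw [wt, Finsupp.add_apply, Finsupp.add_apply, h5, h6, zero_add, zero_add, wt₄]
  by_cases h0 : lab t.2.1 = 4
  · rw [if_pos h0, if_neg fun e : t.2.1 = j => hj4 (e ▸ h0)]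
    rfl
  · rw [if_neg h0, Finsupp.single_apply]
    refine if_congr ⟨fun e => ?_, fun e => by rw [e]⟩ rfl rfl
    exact h.inj _ _ (by omega) (by omega) (Prod.ext_iff.1 e).1

theorem sum_wt_eq_iff (h : Labelling lab L) (ha : Positions a b c) {s s' : Multiset (ℕ × ℕ × ℕ)}
    (hs : ∀ t ∈ s, admissible a b c t = true) (hs' : ∀ t ∈ s', admissible a b c t = true) :
    (s.card = s'.card ∧ (s.map (wt lab a b c)).sum = (s'.map (wt lab a b c)).sum) ↔
      SameMargins s s' := by
  constructor
  · rintro ⟨hc, he⟩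
    have bound : ∀ s : Multiset (ℕ × ℕ × ℕ), (∀ t ∈ s, admissible a b c t = true) → ∀ t ∈ s,
        t.1 < t.2.1 ∧ t.2.1 < 5 ∧ t.2.2 ≤ 3 := fun s hs t ht =>
      have h := admissible_iff.1 (hs t ht)
      ⟨h.1, h.2.1, h.2.2.1.trans (level_le _ _ _ _)⟩
    have mem : ∀ s : Multiset (ℕ × ℕ × ℕ), (∀ t ∈ s, admissible a b c t = true) →
        (∀ x ∈ s.map (fun t => t.1), x ∈ Finset.Icc 0 3) ∧
        (∀ x ∈ s.map (fun t => t.2.1), x ∈ Finset.Icc 1 4) ∧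
        (∀ x ∈ s.map (fun t => t.2.2), x ∈ Finset.Icc 0 3) := by
      intro s hs
      refine ⟨fun x hx => ?_, fun x hx => ?_, fun x hx => ?_⟩ <;>
      · obtain ⟨t, ht, rfl⟩ := Multiset.mem_map.1 hx
        have := bound s hs t ht
        rw [Finset.mem_Icc]
        omega
    obtain ⟨m1, m2, m3⟩ := mem s hs
    obtain ⟨m1', m2', m3'⟩ := mem s' hs'
    refine ⟨eq_of_counts _ 0 m1 m1' (by simpa using hc) fun x hx h0 => ?_, ?_,
      eq_of_counts _ 0 m3 m3' (by simpa using hc) fun x hx h0 => ?_⟩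
    · rw [Finset.mem_Icc] at hx
      rw [← sum_map_apply_eq_count (w := wt lab a b c) (β := (lab x, 5))
        fun t ht => wt_apply_five h (hs t ht) (by omega), he]
      exact sum_map_apply_eq_count fun t ht => wt_apply_five h (hs' t ht) (by omega)
    · obtain ⟨j₀, hj₀⟩ : ∃ j₀, ∀ x ∈ Finset.Icc 1 4, x ≠ j₀ → lab x ≠ 4 := by
        by_cases hex : ∃ j₀ ∈ Finset.Icc 1 4, lab j₀ = 4
        · obtain ⟨j₀, hm, e⟩ := hex
          rw [Finset.mem_Icc] at hm
          refine ⟨j₀, fun x hx hne e' => hne (h.inj _ _ ?_ ?_ (e'.trans e.symm))⟩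
          · rw [Finset.mem_Icc] at hx
            omega
          · omega
        · push Not at hex
          exact ⟨0, fun x hx _ => hex x hx⟩
      refine eq_of_counts _ j₀ m2 m2' (by simpa using hc) fun x hx h0 => ?_
      have h4 := hj₀ x hx h0
      rw [Finset.mem_Icc] at hx
      rw [← sum_map_apply_eq_count (w := wt lab a b c) (β := (lab x, 4))
        fun t ht => wt_apply_four h (hs t ht) (by omega) h4, he]
      exact sum_map_apply_eq_count fun t ht => wt_apply_four h (hs' t ht) (by omega) h4
    · rw [Finset.mem_Icc] at hx
      rw [← sum_map_apply_eq_count (w := wt lab a b c) (β := (lab (place a b c x), 6))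
        fun t ht => wt_apply_six h ha (hs t ht) (by omega), he]
      exact sum_map_apply_eq_count fun t ht => wt_apply_six h ha (hs' t ht) (by omega)
  · intro hm
    have key : ∀ s : Multiset (ℕ × ℕ × ℕ), (s.map (wt lab a b c)).sum =
        ((s.map fun t => t.2.2).map (wt₆ lab a b c)).sum +
          (((s.map fun t => t.1).map (wt₅ lab)).sum +
            ((s.map fun t => t.2.1).map fun j => wt₄ (lab j)).sum) := by
      intro s
      rw [Multiset.map_map, Multiset.map_map, Multiset.map_map, ← Multiset.sum_map_add,
        ← Multiset.sum_map_add]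
      rfl
    exact ⟨hm.card_eq, by rw [key, key, hm.1, hm.2.1, hm.2.2]⟩

theorem wt_injOn (h : Labelling lab L) (ha : Positions a b c) {t t' : ℕ × ℕ × ℕ}
    (ht : admissible a b c t = true) (ht' : admissible a b c t' = true)
    (he : wt lab a b c t = wt lab a b c t') : t = t' := by
  have := (sum_wt_eq_iff h ha (s := {t}) (s' := {t'}) (by simpa using ht) (by simpa using ht')).1
    ⟨rfl, by simpa using he⟩
  simp [SameMargins] at this
  exact Prod.ext this.1 (Prod.ext this.2.1 this.2.2)

end Margins

theorem sorted_triple {x y z : ℕ} (h1 : 1 ≤ x) (h2 : x < y) (h3 : y < z) (h4 : z ≤ 6) :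
    Sorted 3 6 ![x, y, z] := by
  refine ⟨?_, ?_⟩
  · rw [Fin.strictMono_iff_lt_succ]
    simp [Fin.forall_fin_two, h2, h3]
  · simp [Fin.forall_fin_succ]
    omega

theorem HasLead.exists_sorted {S : List (ℕ × ℕ)} {x y z : ℕ} {m : Exponent}
    (h : HasLead S x y z m) (hx : 1 ≤ x ∧ x ≤ 6) (hy : 1 ≤ y ∧ y ≤ 6) (hz : 1 ≤ z ∧ z ≤ 6)
    (hn : [x, y, z].Nodup) : ∃ K : MI 6, HasLead S (K.1 0) (K.1 1) (K.1 2) m := by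
  have key : ∀ x y z, 1 ≤ x → x < y → y < z → z ≤ 6 → HasLead S x y z m →
      ∃ K : MI 6, HasLead S (K.1 0) (K.1 1) (K.1 2) m := fun x y z h1 h2 h3 h4 h =>
    ⟨⟨_, sorted_triple h1 h2 h3 h4⟩, h⟩
  simp at hn
  obtain ⟨⟨n1, n2⟩, n3⟩ := hn
  rcases lt_or_gt_of_ne n1 with g1 | g1 <;> rcases lt_or_gt_of_ne n2 with g2 | g2 <;>
    rcases lt_or_gt_of_ne n3 with g3 | g3
  · exact key x y z (by omega) (by omega) (by omega) (by omega) h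
  · exact key x z y (by omega) (by omega) (by omega) (by omega) h.swap₂₃
  · omega
  · exact key z x y (by omega) (by omega) (by omega) (by omega) h.swap₂₃.swap₁₂
  · exact key y x z (by omega) (by omega) (by omega) (by omega) h.swap₁₂
  · omega
  · exact key y z x (by omega) (by omega) (by omega) (by omega) h.swap₁₂.swap₂₃
  · exact key z y x (by omega) (by omega) (by omega) (by omega) h.swap₁₂.swap₂₃.swap₁₂

theorem MI.bounds (K : MI 6) : 1 ≤ K.1 0 ∧ K.1 0 < K.1 1 ∧ K.1 1 < K.1 2 ∧ K.1 2 ≤ 6 :=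
  ⟨(K.2.2 0).1, K.2.1 (by decide), K.2.1 (by decide), (K.2.2 2).2⟩

theorem MI.ext_iff {K K' : MI 6} :
    K = K' ↔ K.1 0 = K'.1 0 ∧ K.1 1 = K'.1 1 ∧ K.1 2 = K'.1 2 := by
  rw [Subtype.ext_iff, funext_iff]
  simp [Fin.forall_fin_succ]

/-- All strictly increasing triples. -/
def allTriples : Finset (ℕ × ℕ × ℕ) :=
  (Finset.Icc 1 6 ×ˢ Finset.Icc 1 6 ×ˢ Finset.Icc 1 6).filter fun x => x.1 < x.2.1 ∧ x.2.1 < x.2.2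

theorem card_allTriples : allTriples.card = 20 := by decide +kernel

theorem triples_card_check : positionTriples.all (fun x =>
    (triples x.1 x.2.1 x.2.2).length == 20) = true := by decide +kernel

theorem nodup_triples (a b c : ℕ) : (triples a b c).Nodup :=
  List.Nodup.filter _ (by decide +kernel)

theorem Positions.mem {a b c : ℕ} (ha : Positions a b c) : (a, b, c) ∈ positionTriples := by
  simp [positionTriples, ha.lt, ha.ne]

theorem surjective_of_injective {a b c : ℕ} (ha : Positions a b c) {κ : ℕ × ℕ × ℕ → MI 6}
    (hκ : ∀ t t', admissible a b c t = true → admissible a b c t' = true → κ t = κ t' → t = t')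
    (K : MI 6) : ∃ t, admissible a b c t = true ∧ κ t = K := by
  let g : MI 6 → ℕ × ℕ × ℕ := fun K => (K.1 0, K.1 1, K.1 2)
  have hg : ∀ K, g K ∈ allTriples := fun K => by
    have := MI.bounds K
    simp only [g, allTriples, Finset.mem_filter, Finset.mem_product, Finset.mem_Icc]
    omega
  have hlen : (triples a b c).length = 20 := by
    simpa using List.all_eq_true.1 triples_card_check _ ha.mem
  have hinj : Set.InjOn (fun t => g (κ t)) ((triples a b c).toFinset : Set (ℕ × ℕ × ℕ)) := by
    intro t ht t' ht' e
    simp only [List.coe_toFinset, Set.mem_ofPred_eq, mem_triples] at ht ht'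
    refine hκ t t' ht ht' (MI.ext_iff.2 ?_)
    simpa [g] using e
  have himg : (triples a b c).toFinset.image (fun t => g (κ t)) = allTriples := by
    refine Finset.eq_of_subset_of_card_le (Finset.image_subset_iff.2 fun t _ => hg _) ?_
    rw [Finset.card_image_of_injOn hinj, List.toFinset_card_of_nodup (nodup_triples a b c), hlen,
      card_allTriples]
  have hK := hg K
  rw [← himg, Finset.mem_image] at hK
  obtain ⟨t, ht, e⟩ := hK
  rw [List.mem_toFinset, mem_triples] at ht
  exact ⟨t, ht, MI.ext_iff.2 (by simpa [g] using e)⟩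

/-- A description of the leading exponents of the Plücker coordinates by triples. -/
structure Model (S : List (ℕ × ℕ)) (a b c : ℕ) (τ : MI 6 → ℕ × ℕ × ℕ) : Prop where
  mem : (a, b, c) ∈ positionTriples
  adm : ∀ K, admissible a b c (τ K) = true
  inj : Function.Injective τ
  surj : ∀ t, admissible a b c t = true → ∃ K, τ K = t
  lead : ∀ K : MI 6, ∃ ε : ℂ, (ε = 1 ∨ ε = -1) ∧ LexLead S (phiStar 6 S K.1) (valS 6 S K.1) ε
  psi : ∀ K : MI 6, ∀ m ∈ (phiStar 6 S K.1).support, Psi m = Psi (valS 6 S K.1)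
  fst : ∀ β ∈ S, 1 ≤ β.1
  margins : ∀ m m' : MI 6 →₀ ℕ, (m.toMultiset.card = m'.toMultiset.card ∧
    MSdot 6 S m = MSdot 6 S m') ↔ SameMargins (m.toMultiset.map τ) (m'.toMultiset.map τ)

theorem exists_model_seq {lab : ℕ → ℕ} {L : List (ℕ × ℕ)} {a b c : ℕ} (h : Labelling lab L)
    (ha : Positions a b c) : ∃ τ, Model (seq lab L a b c) a b c τ := by
  have hE := extends_six h ha
  have hS1 : ∀ β ∈ seq lab L a b c, 1 ≤ β.1 := by
    intro β hβ
    simp only [seq, extend, List.mem_cons] at hβ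
    rcases hβ with rfl | rfl | rfl | hβ
    · exact hE.pos.1
    · exact hE.pos.2.1
    · exact hE.pos.2.2
    · exact (hE.fst β (by simpa [extend] using hβ)).1
  have hS2 : ∀ β ∈ seq lab L a b c, β.1 ≤ β.2 := by
    have h5 := extends_five h
    intro β hβ
    simp only [seq, extend, List.mem_cons] at hβ
    rcases hβ with rfl | rfl | rfl | rfl | rfl | rfl | hβ
    · exact hE.lt.1.le
    · exact hE.lt.2.1.le
    · exact hE.lt.2.2.le
    · exact h5.lt.1.le
    · exact h5.lt.2.1.le
    · exact h5.lt.2.2.le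
    · have := h.base.subset hβ
      simp at this
      rcases this with rfl | rfl | rfl <;> simp
  set S := seq lab L a b c with hS
  have hex : ∀ t, ∃ K : MI 6, admissible a b c t = true →
      HasLead S (K.1 0) (K.1 1) (K.1 2) (wt lab a b c t) := by
    intro t
    by_cases ht : admissible a b c t = true
    · obtain ⟨x, y, z, hx, hy, hz, hn, hl⟩ := exists_hasLead h ha ht
      obtain ⟨K, hK⟩ := hl.exists_sorted hx hy hz hn
      exact ⟨K, fun _ => hK⟩
    · exact ⟨⟨_, sorted_triple (x := 1) (y := 2) (z := 3) (by norm_num) (by norm_num)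
        (by norm_num) (by norm_num)⟩, fun h => absurd h ht⟩
  choose κ hκ using hex
  have hε : ∀ {ε : ℂ}, (ε = 1 ∨ ε = -1) → ε ≠ 0 := by
    rintro ε (rfl | rfl) <;> norm_num
  have hmem : ∀ {K : MI 6} {m : Exponent}, HasLead S (K.1 0) (K.1 1) (K.1 2) m →
      m ∈ (minor S (K.1 0) (K.1 1) (K.1 2)).support := by
    rintro K m ⟨ε, he, hl⟩
    rw [mem_support_iff, hl.1]
    exact hε he
  have hval : ∀ {K : MI 6} {m : Exponent}, HasLead S (K.1 0) (K.1 1) (K.1 2) m →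
      valS 6 S K.1 = m := by
    intro K m hK
    have hm := hmem hK
    obtain ⟨ε, he, hl⟩ := hK
    rw [valS, phiStar_eq_minor]
    exact minSupp_eq hl (hε he) fun m' hm' => Psi_eq_of_mem_support_minor hS2 hm' hm
  have hsurj := surjective_of_injective ha (κ := κ) fun t t' ht ht' e => wt_injOn h ha ht ht' <| by
    rw [← hval (hκ t ht), ← hval (hκ t' ht'), e]
  choose τ hτ hκτ using hsurj
  have hlead : ∀ K : MI 6, HasLead S (K.1 0) (K.1 1) (K.1 2) (wt lab a b c (τ K)) := fun K => by
    have := hκ _ (hτ K)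
    rwa [hκτ] at this
  refine ⟨τ, ha.mem, hτ, fun K K' e => by rw [← hκτ K, e, hκτ], fun t ht => ⟨κ t, ?_⟩, fun K => ?_,
    fun K m hm => ?_, hS1, fun m m' => ?_⟩
  · refine wt_injOn h ha (hτ _) ht ?_
    rw [← hval (hlead (κ t)), hval (hκ t ht)]
  · rw [hval (hlead K), phiStar_eq_minor]
    exact hlead K
  · rw [hval (hlead K)]
    rw [phiStar_eq_minor] at hm
    exact Psi_eq_of_mem_support_minor hS2 hm (hmem (hlead K))
  · have key : ∀ m : MI 6 →₀ ℕ, MSdot 6 S m = ((m.toMultiset.map τ).map (wt lab a b c)).sum := by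
      intro m
      rw [Multiset.map_map, Finsupp.toMultiset_map, Finsupp.sum_toMultiset]
      rw [Finsupp.sum_mapDomain_index (by simp) (by simp [add_smul]), MSdot]
      exact Finsupp.sum_congr fun K _ => by rw [hval (hlead K)]; rfl
    rw [key, key, ← Multiset.card_map τ m.toMultiset, ← Multiset.card_map τ m'.toMultiset]
    refine sum_wt_eq_iff h ha ?_ ?_ <;>
    · intro t ht
      obtain ⟨K, -, rfl⟩ := Multiset.mem_map.1 ht
      exact hτ K

theorem isIter_four {L : List (ℕ × ℕ)} (h : IsIter 4 L) : L.Perm [(1,4),(2,4),(3,4)] := by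
  generalize hn : 4 = n at h
  cases h with
  | base L hL => exact hL
  | step r L i₁ i₂ i₃ hr => omega

theorem isIter_succ {r : ℕ} (hr : 4 ≤ r) {S : List (ℕ × ℕ)} (h : IsIter (r + 1) S) :
    ∃ L i₁ i₂ i₃, IsIter r L ∧ S = extend (r + 1) i₁ i₂ i₃ L ∧ (1 ≤ i₁ ∧ i₁ ≤ r) ∧
      (1 ≤ i₂ ∧ i₂ ≤ r) ∧ (1 ≤ i₃ ∧ i₃ ≤ r) ∧ i₁ ≠ i₂ ∧ i₁ ≠ i₃ ∧ i₂ ≠ i₃ := by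
  generalize hn : r + 1 = n at h
  cases h with
  | base L hL => omega
  | step r' L i₁ i₂ i₃ hr' hL h1 h2 h3 h4 h5 h6 h7 h8 h9 =>
    obtain rfl : r = r' := by omega
    exact ⟨L, i₁, i₂, i₃, hL, rfl, ⟨h1, h2⟩, ⟨h3, h4⟩, ⟨h5, h6⟩, h7, h8, h9⟩

theorem exists_model {S : List (ℕ × ℕ)} (hS : IsIter 6 S) : ∃ a b c τ, Model S a b c τ := by
  obtain ⟨L', i₁, i₂, i₃, hL', rfl, hi₁, hi₂, hi₃, hi⟩ := isIter_succ (by norm_num) hS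
  obtain ⟨L, j₁, j₂, j₃, hL, rfl, hj₁, hj₂, hj₃, hj⟩ := isIter_succ (by norm_num) hL'
  let lab : ℕ → ℕ := fun p => if p = 0 then 5 else if p = 1 then j₁ else if p = 2 then j₂ else
    if p = 3 then j₃ else 10 - j₁ - j₂ - j₃
  have hlab : Labelling lab L := by
    refine ⟨rfl, fun p h1 h2 => ?_, fun p q hp hq h => ?_, isIter_four hL⟩
    · simp only [lab]
      interval_cases p <;> simp <;> omega
    · simp only [lab] at h
      interval_cases p <;> interval_cases q <;> simp at h ⊢ <;> omega
  have hex : ∀ i, 1 ≤ i → i ≤ 5 → ∃ p < 5, lab p = i := by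
    intro i h1 h2
    by_cases e0 : i = 5
    · exact ⟨0, by norm_num, by simp [lab, e0]⟩
    by_cases e1 : i = j₁
    · exact ⟨1, by norm_num, by simp [lab, e1]⟩
    by_cases e2 : i = j₂
    · exact ⟨2, by norm_num, by simp [lab, e2]⟩
    by_cases e3 : i = j₃
    · exact ⟨3, by norm_num, by simp [lab, e3]⟩
    exact ⟨4, by norm_num, by simp [lab]; omega⟩
  obtain ⟨a, ha, rfl⟩ := hex i₁ hi₁.1 hi₁.2
  obtain ⟨b, hb, rfl⟩ := hex i₂ hi₂.1 hi₂.2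
  obtain ⟨c, hc, rfl⟩ := hex i₃ hi₃.1 hi₃.2
  obtain ⟨τ, hτ⟩ := exists_model_seq hlab (a := a) (b := b) (c := c)
    ⟨⟨ha, hb, hc⟩, fun e => hi.1 (e ▸ rfl), fun e => hi.2.1 (e ▸ rfl), fun e => hi.2.2 (e ▸ rfl)⟩
  exact ⟨a, b, c, τ, hτ⟩

/-- The Plücker variable with the given indices. -/
noncomputable abbrev pv (x y z : ℕ) : PRing 6 := pvar 6 ![x, y, z]

theorem pvar_of_sorted {K : Fin 3 → ℕ} (h : Sorted 3 6 K) : pvar 6 K = X ⟨K, h⟩ := dif_pos h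

theorem pv_eq_zero {x y z : ℕ} (h : x = y ∨ y = z) : pv x y z = 0 := by
  refine dif_neg fun hs => ?_
  have h1 : x < y := hs.1 (show (0 : Fin 3) < 1 by decide)
  have h2 : y < z := hs.1 (show (1 : Fin 3) < 2 by decide)
  omega

/-- The signed Plücker variable with indices `a`, `b`, `j`, where `a < b`. -/
noncomputable def signedPv (a b j : ℕ) : PRing 6 :=
  if j < a then pv j a b else if j < b then -pv a j b else pv a b j

theorem insert3_pair {a b j : ℕ} (hab : a < b) : insert3 ![a, b] j =
    if j < a then ![j, a, b] else if j < b then ![a, j, b] else ![a, b, j] := by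
  funext t
  unfold insert3
  by_cases h1 : j < a
  · have e1 : ¬ b ≤ j := by omega
    have e2 : ¬ a ≤ j := by omega
    fin_cases t <;> simp [List.insertionSort, List.orderedInsert, h1, e1, e2, hab.le]
  · by_cases h2 : j < b
    · have e1 : ¬ b ≤ j := by omega
      have e2 : a ≤ j := by omega
      fin_cases t <;> simp [List.insertionSort, List.orderedInsert, h1, h2, e1, e2]
    · have e1 : b ≤ j := by omega
      fin_cases t <;> simp [List.insertionSort, h1, h2, e1, hab.le]

theorem sign_mul_pvar_insert3 {a b j : ℕ} (hab : a < b) :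
    (-1 : PRing 6) ^ (Finset.univ.filter fun t : Fin 2 => ![a, b] t < j).card *
      pvar 6 (insert3 ![a, b] j) = signedPv a b j := by
  rw [insert3_pair hab, signedPv, Finset.card_filter, Fin.sum_univ_two]
  simp only [Matrix.cons_val_zero, Matrix.cons_val_one]
  by_cases h1 : j < a
  · simp [h1, h1.not_gt, (h1.trans hab).not_gt, pv]
  · by_cases h2 : j < b
    · by_cases e : a = j
      · subst e
        rw [if_neg h1, if_pos h2, if_neg h1, if_pos h2, ← pv, pv_eq_zero (Or.inl rfl), mul_zero,
          neg_zero]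
      · have e1 : a < j := by omega
        simp [h1, h2, e1, h2.not_gt, pv]
    · by_cases e : b = j
      · subst e
        rw [if_neg h1, if_neg h2, if_neg h1, if_neg h2, ← pv, pv_eq_zero (Or.inr rfl), mul_zero]
      · have e1 : b < j := by omega
        simp [h1, h2, e1, hab.trans e1, pv]

theorem Rrel_eq {a b c d e f : ℕ} (hab : a < b) (hcd : c < d) (hde : d < e) (hef : e < f) :
    Rrel 6 ![a, b] ![c, d, e, f] = -(signedPv a b c * pv d e f) + signedPv a b d * pv c e f -
      signedPv a b e * pv c d f + signedPv a b f * pv c d e := by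
  have g1 : erase4 ![c, d, e, f] c = ![d, e, f] := by
    funext t
    fin_cases t <;> simp [erase4]
  have g2 : erase4 ![c, d, e, f] d = ![c, e, f] := by
    funext t
    fin_cases t <;> simp [erase4, hcd.ne]
  have g3 : erase4 ![c, d, e, f] e = ![c, d, f] := by
    funext t
    fin_cases t <;> simp [erase4, hde.ne, (hcd.trans hde).ne]
  have g4 : erase4 ![c, d, e, f] f = ![c, d, e] := by
    funext t
    fin_cases t <;>
      simp [erase4, hef.ne, (hde.trans hef).ne, (hcd.trans (hde.trans hef)).ne]
  have c1 : (Finset.univ.filter fun t : Fin 4 => c < ![c, d, e, f] t).card = 3 := by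
    rw [Finset.card_filter, Fin.sum_univ_four]
    simp [hcd, hcd.trans hde, hcd.trans (hde.trans hef)]
  have c2 : (Finset.univ.filter fun t : Fin 4 => d < ![c, d, e, f] t).card = 2 := by
    rw [Finset.card_filter, Fin.sum_univ_four]
    simp [hcd.not_gt, hde, hde.trans hef]
  have c3 : (Finset.univ.filter fun t : Fin 4 => e < ![c, d, e, f] t).card = 1 := by
    rw [Finset.card_filter, Fin.sum_univ_four]
    simp [hde.not_gt, (hcd.trans hde).not_gt, hef]
  have c4 : (Finset.univ.filter fun t : Fin 4 => f < ![c, d, e, f] t).card = 0 := by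
    rw [Finset.card_filter, Fin.sum_univ_four]
    simp [hef.not_gt, (hde.trans hef).not_gt, (hcd.trans (hde.trans hef)).not_gt]
  rw [Rrel, Fin.sum_univ_four]
  have v0 : ![c, d, e, f] 0 = c := rfl
  have v1 : ![c, d, e, f] 1 = d := rfl
  have v2 : ![c, d, e, f] 2 = e := rfl
  have v3 : ![c, d, e, f] 3 = f := rfl
  simp only [v0, v1, v2, v3, g1, g2, g3, g4, c1, c2, c3, c4, ← sign_mul_pvar_insert3 hab]
  ring

/-- The homomorphism sending each Plücker variable to the corresponding minor, made
homogeneous by the variable `(0,0)`. -/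
noncomputable def coordHom (S : List (ℕ × ℕ)) : PRing 6 →ₐ[ℂ] MvPolynomial (ℕ × ℕ) ℂ :=
  aeval fun K => X (0, 0) * phiStar 6 S K.1

theorem coordHom_pv (S : List (ℕ × ℕ)) {x y z : ℕ} (h1 : 1 ≤ x) (h2 : x ≤ y) (h3 : y ≤ z)
    (h4 : z ≤ 6) : coordHom S (pv x y z) = X (0, 0) * minor S x y z := by
  by_cases h : x = y ∨ y = z
  · have hm : minor S x y z = 0 := by
      rw [minor_eq]
      rcases h with rfl | rfl <;> ring
    rw [pv_eq_zero h, hm, map_zero, mul_zero]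
  · rw [pv, pvar_of_sorted (sorted_triple h1 (by omega) (by omega) h4), coordHom, aeval_X,
      phiStar_eq_minor]
    rfl

theorem coordHom_signedPv (S : List (ℕ × ℕ)) {a b j : ℕ} (h1 : 1 ≤ a) (h2 : a < b) (h3 : b ≤ 6)
    (hj : 1 ≤ j ∧ j ≤ 6) : coordHom S (signedPv a b j) = X (0, 0) * minor S a b j := by
  unfold signedPv
  split_ifs with g1 g2
  · rw [coordHom_pv S hj.1 g1.le h2.le h3, minor_swap₂₃ S a j b, minor_swap₁₂ S j a b]
    ring
  · rw [map_neg, coordHom_pv S h1 (by omega) g2.le h3, minor_swap₂₃ S a j b]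
    ring
  · rw [coordHom_pv S h1 h2.le (by omega) hj.2]

theorem minor_relation (S : List (ℕ × ℕ)) (a b c d e f : ℕ) :
    -(minor S a b c * minor S d e f) + minor S a b d * minor S c e f -
      minor S a b e * minor S c d f + minor S a b f * minor S c d e = 0 := by
  simp only [minor_eq]
  ring

theorem coordHom_eq_zero (S : List (ℕ × ℕ)) {f : PRing 6} (hf : f ∈ PluckerIdeal 6) :
    coordHom S f = 0 := by
  suffices h : PluckerIdeal 6 ≤ RingHom.ker (coordHom S) from h hf
  refine Ideal.span_le.2 ?_
  rintro _ ⟨I, J, hI, hJ, rfl⟩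
  have eI : I = ![I 0, I 1] := by funext t; fin_cases t <;> rfl
  have eJ : J = ![J 0, J 1, J 2, J 3] := by funext t; fin_cases t <;> rfl
  have l0 : I 0 < I 1 := hI.1 (by decide)
  have l1 : J 0 < J 1 := hJ.1 (by decide)
  have l2 : J 1 < J 2 := hJ.1 (by decide)
  have l3 : J 2 < J 3 := hJ.1 (by decide)
  have b0 := (hI.2 0).1
  have b1 := (hI.2 1).2
  have b2 := (hJ.2 0).1
  have b3 := (hJ.2 3).2
  rw [SetLike.mem_coe, RingHom.mem_ker, eI, eJ, Rrel_eq l0 l1 l2 l3]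
  simp only [map_add, map_sub, map_neg, map_mul]
  rw [coordHom_signedPv S b0 l0 b1 ⟨by omega, by omega⟩, coordHom_signedPv S b0 l0 b1
    ⟨by omega, by omega⟩, coordHom_signedPv S b0 l0 b1 ⟨by omega, by omega⟩,
    coordHom_signedPv S b0 l0 b1 ⟨by omega, by omega⟩,
    coordHom_pv S (by omega) (by omega) (by omega) (by omega),
    coordHom_pv S (by omega) (by omega) (by omega) (by omega),
    coordHom_pv S (by omega) (by omega) (by omega) (by omega),
    coordHom_pv S (by omega) (by omega) (by omega) (by omega)]
  linear_combination (X (0, 0)) ^ 2 * minor_relation S (I 0) (I 1) (J 0) (J 1) (J 2) (J 3)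

section Initial

variable {S : List (ℕ × ℕ)} {a b c : ℕ} {τ : MI 6 → ℕ × ℕ × ℕ}

/-- The position of an exponent in the order `psiLT`. -/
def psiKey (S : List (ℕ × ℕ)) (m : Exponent) : ℕ ×ₗ (List ℕ)ᵒᵈ :=
  toLex (Psi m, OrderDual.toDual (S.map m))

theorem psiLT_iff_key {m m' : Exponent} : psiLT S m m' ↔ psiKey S m < psiKey S m' := psiLT_iff

theorem psiLE_iff_key {m m' : Exponent} : psiLE S m m' ↔ psiKey S m ≤ psiKey S m' := psiLE_iff

/-- The exponent of a Plücker coordinate, with its degree. -/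
noncomputable def colWt (S : List (ℕ × ℕ)) (K : MI 6) : Exponent :=
  Finsupp.single (0, 0) 1 + valS 6 S K.1

/-- The exponent of a monomial in the Plücker coordinates, with its degree. -/
noncomputable def monWt (S : List (ℕ × ℕ)) (m : MI 6 →₀ ℕ) : Exponent :=
  m.sum fun K k => k • colWt S K

theorem monWt_eq (m : MI 6 →₀ ℕ) :
    monWt S m = Finsupp.single (0, 0) m.toMultiset.card + MSdot 6 S m := by
  rw [monWt, MSdot, Finsupp.card_toMultiset, Finsupp.sum, Finsupp.sum, Finsupp.sum,
    Finsupp.single_finsetSum, ← Finset.sum_add_distrib]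
  refine Finset.sum_congr rfl fun K _ => ?_
  rw [colWt, smul_add, Finsupp.smul_single]
  simp

theorem psiKey_single_add (h : ∀ β ∈ S, 1 ≤ β.1) (d : ℕ) (m : Exponent) :
    psiKey S (Finsupp.single (0, 0) d + m) = psiKey S m := by
  unfold psiKey
  congr 2
  · rw [Psi_add]
    simp [Psi, Ht]
  · congr 1
    refine List.map_congr_left fun β hβ => ?_
    have : (0, 0) ≠ β := fun e => by
      have := h β hβ
      rw [← e] at this
      simp at this
    rw [Finsupp.add_apply, Finsupp.single_eq_of_ne this.symm, zero_add]

theorem psiKey_monWt (h : ∀ β ∈ S, 1 ≤ β.1) (m : MI 6 →₀ ℕ) :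
    psiKey S (monWt S m) = psiKey S (MSdot 6 S m) := by
  rw [monWt_eq, psiKey_single_add h]

theorem zero_apply_of_mem_support (h : ∀ β ∈ S, 1 ≤ β.1) {K : MI 6} {m : Exponent}
    (hm : m ∈ (phiStar 6 S K.1).support) : m (0, 0) = 0 := by
  rw [phiStar_eq_minor] at hm
  exact eq_zero_of_mem_polyIn (minor_mem_polyIn S _ _ _) hm fun h' => by simpa using h _ h'

theorem Model.val_mem (M : Model S a b c τ) (K : MI 6) :
    valS 6 S K.1 ∈ (phiStar 6 S K.1).support := by
  obtain ⟨ε, he, hl⟩ := M.lead K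
  rw [mem_support_iff, hl.1]
  rcases he with rfl | rfl <;> norm_num

/-- The leading coefficient of a Plücker coordinate. -/
noncomputable def colSign (S : List (ℕ × ℕ)) (K : MI 6) : ℂ :=
  coeff (valS 6 S K.1) (phiStar 6 S K.1)

theorem Model.colSign_mul_self (M : Model S a b c τ) (K : MI 6) :
    colSign S K * colSign S K = 1 := by
  obtain ⟨ε, he, hl⟩ := M.lead K
  rw [colSign, hl.1]
  rcases he with rfl | rfl <;> norm_num

theorem Model.lead_X (M : Model S a b c τ) (K : MI 6) :
    Lead (degLT S) (X (0, 0) * phiStar 6 S K.1) (colWt S K) (colSign S K) := by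
  refine ⟨by rw [colWt, coeff_X_mul, colSign], fun m' hm' hne => ?_⟩
  rw [support_X_mul, Finset.mem_map] at hm'
  obtain ⟨m, hm, rfl⟩ := hm'
  rw [addLeftEmbedding_apply] at hne ⊢
  obtain ⟨ε, -, hl⟩ := M.lead K
  refine ⟨?_, Or.inr ⟨?_, ?_⟩⟩
  · rw [colWt, Finsupp.add_apply, Finsupp.add_apply, zero_apply_of_mem_support M.fst hm,
      zero_apply_of_mem_support M.fst (M.val_mem K)]
  · rw [colWt, Psi_add, Psi_add, M.psi K m hm]
  · exact lexLT_add _ (hl.2 m hm fun e => hne (by rw [e, colWt]))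

/-- The leading coefficient of a monomial in the Plücker coordinates. -/
noncomputable def monSign (S : List (ℕ × ℕ)) (m : MI 6 →₀ ℕ) : ℂ :=
  m.prod fun K k => colSign S K ^ k

theorem Model.monSign_mul_self (M : Model S a b c τ) (m : MI 6 →₀ ℕ) :
    monSign S m * monSign S m = 1 := by
  rw [monSign, Finsupp.prod, ← Finset.prod_mul_distrib]
  refine Finset.prod_eq_one fun K _ => ?_
  rw [← mul_pow, M.colSign_mul_self, one_pow]

theorem Model.monSign_ne_zero (M : Model S a b c τ) (m : MI 6 →₀ ℕ) : monSign S m ≠ 0 := fun h => by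
  simpa [h] using M.monSign_mul_self m

theorem Model.lead_monomial (M : Model S a b c τ) (m : MI 6 →₀ ℕ) :
    Lead (degLT S) (coordHom S (monomial m 1)) (monWt S m) (monSign S m) := by
  rw [coordHom, aeval_monomial, map_one, one_mul]
  exact Lead.prod (isExponentOrder_degLT S) _ fun K _ =>
    (M.lead_X K).pow (isExponentOrder_degLT S) _

theorem coeff_coordHom (f : PRing 6) (e : Exponent) : coeff e (coordHom S f) =
    ∑ m ∈ f.support, coeff m f * coeff e (coordHom S (monomial m 1)) := by
  conv_lhs => rw [f.as_sum, map_sum, coeff_sum]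
  refine Finset.sum_congr rfl fun m _ => ?_
  have : monomial m (coeff m f) = coeff m f • (monomial m 1 : PRing 6) := by
    rw [smul_monomial, smul_eq_mul, mul_one]
  rw [this, map_smul, coeff_smul, smul_eq_mul]

/-- The monomial homomorphism of leading terms. -/
noncomputable def leadHom (S : List (ℕ × ℕ)) : PRing 6 →ₐ[ℂ] MvPolynomial (ℕ × ℕ) ℂ :=
  aeval fun K => monomial (colWt S K) (colSign S K)

theorem leadHom_monomial (m : MI 6 →₀ ℕ) (r : ℂ) :
    leadHom S (monomial m r) = monomial (monWt S m) (r * monSign S m) := by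
  rw [leadHom, aeval_monomial, monWt, monSign, Finsupp.prod, Finsupp.sum, Finsupp.prod]
  simp_rw [monomial_pow]
  rw [← monomial_sum_prod, algebraMap_eq, C_mul_monomial]

theorem Model.degLT_or_eq (M : Model S a b c τ) {m : MI 6 →₀ ℕ} {e : Exponent}
    (h : coeff e (coordHom S (monomial m 1)) ≠ 0) : e = monWt S m ∨ degLT S (monWt S m) e :=
  or_iff_not_imp_left.2 fun hne => (M.lead_monomial m).2 e (mem_support_iff.2 h) hne

theorem Model.leadHom_inM (M : Model S a b c τ) {f : PRing 6} (hf : f ∈ PluckerIdeal 6) :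
    leadHom S (inM 6 S f) = 0 := by
  classical
  ext e
  rw [inM, map_sum, coeff_sum, coeff_zero]
  simp_rw [leadHom_monomial, coeff_monomial]
  by_cases hex : ∃ m₀ ∈ f.support,
      (∀ m' ∈ f.support, psiLE S (MSdot 6 S m₀) (MSdot 6 S m')) ∧ monWt S m₀ = e
  · obtain ⟨m₀, -, hm₀', rfl⟩ := hex
    have h0 := coeff_coordHom (S := S) f (monWt S m₀)
    rw [coordHom_eq_zero S hf, coeff_zero] at h0
    refine Eq.trans ?_ h0.symm
    rw [Finset.sum_filter]
    refine Finset.sum_congr rfl fun m hm => ?_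
    have hle := hm₀' m hm
    rw [psiLE_iff_key, ← psiKey_monWt M.fst, ← psiKey_monWt M.fst m] at hle
    by_cases he : monWt S m = monWt S m₀
    · have hmin : ∀ m' ∈ f.support, psiLE S (MSdot 6 S m) (MSdot 6 S m') := fun m' h => by
        have := hm₀' m' h
        rw [psiLE_iff_key, ← psiKey_monWt M.fst] at this ⊢
        rwa [he]
      rw [if_pos hmin, if_pos he, ← he, (M.lead_monomial m).1]
    · rw [if_neg he, ite_self]
      by_contra h
      rcases M.degLT_or_eq (right_ne_zero_of_mul (Ne.symm h)) with h | h
      · exact he h.symm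
      · exact absurd (psiLT_iff_key.1 h.2) hle.not_gt
  · push Not at hex
    refine Finset.sum_eq_zero fun m hm => ?_
    rw [Finset.mem_filter] at hm
    exact if_neg (hex m hm.1 hm.2)

/-- A monomial normalised by the sign of its leading coefficient. -/
noncomputable def signedMon (S : List (ℕ × ℕ)) (m : MI 6 →₀ ℕ) : PRing 6 :=
  monomial m (monSign S m)

theorem Model.leadHom_signedMon (M : Model S a b c τ) (m : MI 6 →₀ ℕ) :
    leadHom S (signedMon S m) = monomial (monWt S m) 1 := by
  rw [signedMon, leadHom_monomial, M.monSign_mul_self]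

theorem Model.ker_leadHom_le (M : Model S a b c τ) {I : Ideal (PRing 6)}
    (hI : ∀ m m', monWt S m = monWt S m' → signedMon S m - signedMon S m' ∈ I) :
    RingHom.ker (leadHom S) ≤ I := by
  classical
  let sec : Exponent → (MI 6 →₀ ℕ) := Function.invFun (monWt S)
  have hsec : ∀ m, monWt S (sec (monWt S m)) = monWt S m := fun m =>
    Function.invFun_eq ⟨m, rfl⟩
  let π : PRing 6 →ₗ[ℂ] PRing 6 ⧸ I := (Ideal.Quotient.mkₐ ℂ I).toLinearMap
  let Λ : MvPolynomial (ℕ × ℕ) ℂ →ₗ[ℂ] PRing 6 ⧸ I :=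
    (basisMonomials (ℕ × ℕ) ℂ).constr ℂ fun e => π (signedMon S (sec e))
  have hΛ : Λ ∘ₗ (leadHom S).toLinearMap = π := by
    refine (basisMonomials (MI 6) ℂ).ext fun m => ?_
    have h1 : (monomial m 1 : PRing 6) = monSign S m • signedMon S m := by
      rw [signedMon, smul_monomial, smul_eq_mul, M.monSign_mul_self]
    have h2 : π (signedMon S m) = π (signedMon S (sec (monWt S m))) :=
      Ideal.Quotient.eq.2 (hI _ _ (hsec m).symm)
    have h3 : Λ (monomial (monWt S m) 1) = π (signedMon S (sec (monWt S m))) := by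
      have := Module.Basis.constr_basis (basisMonomials (ℕ × ℕ) ℂ) ℂ
        (fun e => π (signedMon S (sec e))) (monWt S m)
      rwa [coe_basisMonomials] at this
    rw [coe_basisMonomials]
    change (Λ ∘ₗ (leadHom S).toLinearMap) (monomial m 1) = π (monomial m 1)
    rw [h1, map_smul, map_smul, LinearMap.comp_apply, AlgHom.toLinearMap_apply,
      M.leadHom_signedMon, h2, h3]
  intro f hf
  have := LinearMap.congr_fun hΛ f
  rw [LinearMap.comp_apply, AlgHom.toLinearMap_apply, RingHom.mem_ker.1 hf, map_zero] at this
  exact Ideal.Quotient.eq_zero_iff_mem.1 this.symm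

theorem Model.inM_sub (M : Model S a b c τ) {f r : PRing 6} (hf : f ≠ 0) {e : Exponent}
    (hfe : ∀ m ∈ f.support, monWt S m = e)
    (hr : ∀ m ∈ r.support, psiKey S e < psiKey S (monWt S m)) : inM 6 S (f - r) = f := by
  classical
  have hfr : ∀ m ∈ f.support, coeff m (f - r) = coeff m f := fun m hm => by
    have : m ∉ r.support := fun h => by
      have := hr m h
      rw [hfe m hm] at this
      exact lt_irrefl _ this
    rw [coeff_sub, notMem_support_iff.1 this, sub_zero]
  have hsub : ∀ m ∈ (f - r).support, m ∈ f.support ∨ m ∈ r.support := fun m hm =>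
    Finset.mem_union.1 (support_sub _ f r hm)
  have hle : ∀ m ∈ (f - r).support, psiKey S e ≤ psiKey S (monWt S m) := fun m hm => by
    rcases hsub m hm with h | h
    · rw [hfe m h]
    · exact (hr m h).le
  have hsupp : ∀ m ∈ f.support, m ∈ (f - r).support := fun m hm => by
    rw [mem_support_iff, hfr m hm]
    exact mem_support_iff.1 hm
  obtain ⟨m₀, hm₀⟩ := support_nonempty.2 hf
  ext k
  rw [inM, coeff_sum]
  simp_rw [coeff_monomial]
  simp only [Finset.sum_ite_eq', Finset.mem_filter, psiLE_iff_key, ← psiKey_monWt M.fst]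
  by_cases hk : k ∈ f.support
  · rw [if_pos ⟨hsupp k hk, fun m hm => by rw [hfe k hk]; exact hle m hm⟩, hfr k hk]
  · rw [notMem_support_iff.1 hk, if_neg]
    rintro ⟨h1, h2⟩
    have h3 := hr k ((hsub k h1).resolve_left hk)
    have h4 := h2 m₀ (hsupp m₀ hm₀)
    rw [hfe m₀ hm₀] at h4
    exact absurd h3 h4.not_gt

theorem Model.exists_lead_of_sum (M : Model S a b c τ) {ι : Type*} [Fintype ι]
    {g : ι → (MI 6 →₀ ℕ)} (hg : Function.Injective fun i => monWt S (g i)) {r : ι → ℂ}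
    (hr : r ≠ 0) : ∃ i, (∀ j, r j ≠ 0 → psiKey S (monWt S (g i)) ≤ psiKey S (monWt S (g j))) ∧
      coeff (monWt S (g i)) (coordHom S (∑ j, r j • (monomial (g j) 1 : PRing 6))) ≠ 0 := by
  classical
  have hne : (Finset.univ.filter fun i => r i ≠ 0).Nonempty := by
    obtain ⟨i, hi⟩ := Function.ne_iff.1 hr
    exact ⟨i, by simpa using hi⟩
  obtain ⟨i, hi, hmin⟩ := Finset.exists_min_image _ (fun i => psiKey S (monWt S (g i))) hne
  simp only [Finset.mem_filter, Finset.mem_univ, true_and] at hi hmin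
  refine ⟨i, hmin, ?_⟩
  rw [map_sum, coeff_sum, Finset.sum_eq_single i]
  · rw [map_smul, coeff_smul, (M.lead_monomial _).1]
    exact mul_ne_zero hi (M.monSign_ne_zero _)
  · intro j _ hj
    rw [map_smul, coeff_smul, smul_eq_mul]
    by_contra h
    rcases M.degLT_or_eq (right_ne_zero_of_mul h) with h' | h'
    · exact hj (hg h').symm
    · exact absurd (psiLT_iff_key.1 h'.2) (hmin j (left_ne_zero_of_mul h)).not_gt
  · simp

end Initial

section Toric

variable {S : List (ℕ × ℕ)} {a b c : ℕ} {τ : MI 6 → ℕ × ℕ × ℕ}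

theorem Model.monWt_eq_iff (M : Model S a b c τ) (m m' : MI 6 →₀ ℕ) : monWt S m = monWt S m' ↔
    SameMargins (m.toMultiset.map τ) (m'.toMultiset.map τ) := by
  rw [← M.margins, monWt_eq, monWt_eq]
  refine ⟨fun h => ?_, fun h => by rw [h.1, h.2]⟩
  have h0 : ∀ m : MI 6 →₀ ℕ, MSdot 6 S m (0, 0) = 0 := fun m => by
    rw [MSdot, Finsupp.sum, Finsupp.finsetSum_apply]
    refine Finset.sum_eq_zero fun K _ => ?_
    rw [Finsupp.smul_apply, zero_apply_of_mem_support M.fst (M.val_mem K), smul_zero]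
  have h1 : m.toMultiset.card = m'.toMultiset.card := by
    simpa [h0] using DFunLike.congr_fun h (0, 0)
  exact ⟨h1, add_left_cancel (h1 ▸ h)⟩

theorem signedMon_toFinsupp (s : Multiset (MI 6)) : signedMon S (Multiset.toFinsupp s) =
    (s.map fun K => (C (colSign S K) * X K : PRing 6)).prod := by
  induction s using Multiset.induction with
  | empty => simp [signedMon, monSign]
  | cons K s ih =>
    rw [Multiset.map_cons, Multiset.prod_cons, ← ih, ← Multiset.singleton_add, map_add,
      Multiset.toFinsupp_singleton, signedMon, signedMon, C_mul_X_eq_monomial, monomial_mul,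
      monSign, Finsupp.prod_add_index' (fun _ => pow_zero _) fun _ _ _ => pow_add _ _ _,
      Finsupp.prod_single_index (h := fun K k => colSign S K ^ k) (pow_zero _), pow_one, monSign]

theorem signedMon_eq_prod (m : MI 6 →₀ ℕ) : signedMon S m =
    (m.toMultiset.map fun K => (C (colSign S K) * X K : PRing 6)).prod := by
  rw [← signedMon_toFinsupp, Finsupp.toMultiset_toFinsupp]

theorem exists_X_mul_X {m : MI 6 →₀ ℕ} (hm : m.toMultiset.card = 2) :
    ∃ K L, (monomial m 1 : PRing 6) = X K * X L := by
  obtain ⟨K, L, h⟩ := Multiset.card_eq_two.1 hm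
  refine ⟨K, L, ?_⟩
  rw [← Finsupp.toMultiset_toFinsupp m, h, Multiset.insert_eq_cons, ← Multiset.singleton_add,
    map_add, Multiset.toFinsupp_singleton, Multiset.toFinsupp_singleton, X, X, monomial_mul,
    one_mul]

instance : Nonempty (MI 6) :=
  ⟨⟨![1, 2, 3], sorted_triple (by norm_num) (by norm_num) (by norm_num) (by norm_num)⟩⟩

theorem Model.exists_quadratic_monomials (M : Model S a b c τ) :
    ∃ (n : ℕ) (g : Fin n → MI 6 →₀ ℕ), 175 ≤ n ∧ (∀ i, (g i).toMultiset.card = 2) ∧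
      Function.Injective fun i => monWt S (g i) := by
  obtain ⟨l, hl, hadm, hpair⟩ := exists_margins M.mem
  have hκ : ∀ t, admissible a b c t = true → τ (Function.invFun τ t) = t := fun t ht =>
    Function.invFun_eq (M.surj t ht)
  refine ⟨l.length, fun i => Multiset.toFinsupp
    {Function.invFun τ (l.get i).1, Function.invFun τ (l.get i).2}, hl, fun i => ?_,
    .of_lt_imp_ne fun i j hij h => ?_⟩
  · rw [Multiset.toFinsupp_toMultiset, Multiset.card_pair]
  · rw [M.monWt_eq_iff, Multiset.toFinsupp_toMultiset, Multiset.toFinsupp_toMultiset] at h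
    have hi := hadm _ (l.get_mem i)
    have hj := hadm _ (l.get_mem j)
    simp only [Multiset.insert_eq_cons, Multiset.map_cons, Multiset.map_singleton] at h
    rw [hκ _ hi.1, hκ _ hi.2, hκ _ hj.1, hκ _ hj.2] at h
    exact List.pairwise_iff_get.1 hpair i j hij h

/-- The quadratic part of the Plücker algebra has dimension at most `175`. -/
def QuadraticBound : Prop :=
  ∃ s : Finset (PRing 6 ⧸ PluckerIdeal 6), s.card ≤ 175 ∧
    ∀ K L, Ideal.Quotient.mkₐ ℂ (PluckerIdeal 6) (X K * X L) ∈ Submodule.span ℂ (s : Set _)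

theorem Model.exists_quadratic_reduction (M : Model S a b c τ) (hs : QuadraticBound) :
    ∃ (n : ℕ) (g : Fin n → MI 6 →₀ ℕ), Function.Injective (fun i => monWt S (g i)) ∧
      ∀ f : PRing 6, (∀ m ∈ f.support, m.toMultiset.card = 2) →
        ∃ r : Fin n → ℂ, f - ∑ i, r i • (monomial (g i) 1 : PRing 6) ∈ PluckerIdeal 6 := by
  obtain ⟨n, g, hn, hg2, hg⟩ := M.exists_quadratic_monomials
  obtain ⟨s, hs, hsp⟩ := hs
  refine ⟨n, g, hg, fun f hf => ?_⟩
  set π := (Ideal.Quotient.mkₐ ℂ (PluckerIdeal 6)).toLinearMap with hπ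
  have hker : ∀ x, π x = 0 ↔ x ∈ PluckerIdeal 6 := fun x => Ideal.Quotient.eq_zero_iff_mem
  have hV : ∀ m : MI 6 →₀ ℕ, m.toMultiset.card = 2 →
      π (monomial m 1) ∈ Submodule.span ℂ (s : Set (PRing 6 ⧸ PluckerIdeal 6)) := fun m hm => by
    obtain ⟨K, L, h⟩ := exists_X_mul_X hm
    rw [h]
    exact hsp K L
  have hli : LinearIndependent ℂ fun i => π (monomial (g i) 1) := by
    rw [Fintype.linearIndependent_iff]
    intro r hr
    by_contra! h
    obtain ⟨i, -, hi⟩ := M.exists_lead_of_sum hg (r := r) fun e => by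
      obtain ⟨i, hi⟩ := h
      exact hi (congrFun e i)
    refine hi ?_
    rw [coordHom_eq_zero S ((hker _).1 _), coeff_zero]
    rw [map_sum, ← hr]
    exact Finset.sum_congr rfl fun i _ => map_smul _ _ _
  have hle : Submodule.span ℂ (Set.range fun i => π (monomial (g i) 1)) ≤
      Submodule.span ℂ (s : Set (PRing 6 ⧸ PluckerIdeal 6)) :=
    Submodule.span_le.2 (Set.range_subset_iff.2 fun i => hV _ (hg2 i))
  have heq := Submodule.eq_of_le_of_finrank_le hle <| by
    rw [finrank_span_eq_card hli, Fintype.card_fin]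
    exact (finrank_span_finset_le_card s).trans (hs.trans hn)
  have hfm : π f ∈ Submodule.span ℂ (Set.range fun i => π (monomial (g i) 1)) := by
    rw [heq, f.as_sum, map_sum]
    refine Submodule.sum_mem _ fun m hm => ?_
    have : monomial m (coeff m f) = coeff m f • (monomial m 1 : PRing 6) := by
      rw [smul_monomial, smul_eq_mul, mul_one]
    rw [this, map_smul]
    exact Submodule.smul_mem _ _ (hV m (hf m hm))
  obtain ⟨r, hr⟩ := (Submodule.mem_span_range_iff_exists_fun ℂ).1 hfm
  refine ⟨r, (hker _).1 ?_⟩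
  rw [map_sub, map_sum, ← hr, sub_eq_zero]
  exact Finset.sum_congr rfl fun i _ => (map_smul _ _ _).symm

theorem inM_zero : inM 6 S 0 = 0 := by simp [inM]

theorem coordHom_signedMon (m : MI 6 →₀ ℕ) :
    coordHom S (signedMon S m) = monSign S m • coordHom S (monomial m 1) := by
  rw [← map_smul, signedMon, smul_monomial, smul_eq_mul, mul_one]

theorem mem_support_signedMon_sub {m m' k : MI 6 →₀ ℕ}
    (hk : k ∈ (signedMon S m - signedMon S m').support) : k = m ∨ k = m' := by
  classical
  rcases Finset.mem_union.1 (support_sub _ _ _ hk) with h | h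
  · exact Or.inl (Finset.mem_singleton.1 (support_monomial_subset h))
  · exact Or.inr (Finset.mem_singleton.1 (support_monomial_subset h))

theorem Model.quadratic_sub_mem (M : Model S a b c τ) (hs : QuadraticBound) {m m' : MI 6 →₀ ℕ}
    (hm : m.toMultiset.card = 2) (hm' : m'.toMultiset.card = 2) (h : monWt S m = monWt S m') :
    signedMon S m - signedMon S m' ∈ InIdeal 6 S := by
  classical
  set f := signedMon S m - signedMon S m' with hf
  by_cases hf0 : f = 0
  · rw [hf0]
    exact zero_mem _
  obtain ⟨n, g, hg, hred⟩ := M.exists_quadratic_reduction hs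
  obtain ⟨r, hr⟩ := hred f fun k hk => by
    rcases mem_support_signedMon_sub hk with rfl | rfl <;> assumption
  set R : PRing 6 := ∑ i, r i • (monomial (g i) 1 : PRing 6) with hR
  have hin : inM 6 S (f - R) = f := by
    refine M.inM_sub hf0 (e := monWt S m) (fun k hk => ?_) fun k hk => ?_
    · rcases mem_support_signedMon_sub hk with rfl | rfl
      · rfl
      · exact h.symm
    · obtain ⟨j, -, hj⟩ := Finset.mem_biUnion.1 (support_sum hk)
      obtain ⟨hrj, rfl⟩ : r j ≠ 0 ∧ k = g j := by
        rw [smul_monomial, smul_eq_mul, mul_one, mem_support_iff, coeff_monomial] at hj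
        split_ifs at hj with e
        · exact ⟨hj, e.symm⟩
        · exact absurd rfl hj
      obtain ⟨i, hmin, hi⟩ := M.exists_lead_of_sum hg (r := r) fun e => hrj (congrFun e j)
      refine lt_of_lt_of_le ?_ (hmin j hrj)
      have hfR : coordHom S f = coordHom S R := by
        have := coordHom_eq_zero S hr
        rwa [map_sub, sub_eq_zero] at this
      rw [← hR, ← hfR, hf, map_sub, coordHom_signedMon, coordHom_signedMon, coeff_sub, coeff_smul,
        coeff_smul, smul_eq_mul, smul_eq_mul] at hi
      have hne : monWt S (g i) ≠ monWt S m := fun e => hi <| by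
        have h2 := (M.lead_monomial m').1
        rw [← h] at h2
        rw [e, (M.lead_monomial m).1, h2, M.monSign_mul_self, M.monSign_mul_self, sub_self]
      suffices h2 : degLT S (monWt S m) (monWt S (g i)) from psiLT_iff_key.1 h2.2
      by_cases h3 : coeff (monWt S (g i)) (coordHom S (monomial m 1)) = 0
      · by_cases h4 : coeff (monWt S (g i)) (coordHom S (monomial m' 1)) = 0
        · exact absurd (by rw [h3, h4, mul_zero, mul_zero, sub_zero]) hi
        · rw [h] at hne ⊢
          exact (M.degLT_or_eq h4).resolve_left hne
      · exact (M.degLT_or_eq h3).resolve_left hne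
  refine Ideal.subset_span ⟨f - R, hr, fun h0 => hf0 ?_, hin.symm⟩
  rw [← hin, h0, inM_zero]

theorem Model.signedMon_sub_mem (M : Model S a b c τ) (hs : QuadraticBound) (m m' : MI 6 →₀ ℕ)
    (h : monWt S m = monWt S m') : signedMon S m - signedMon S m' ∈ InIdeal 6 S := by
  have hκ : ∀ t, admissible a b c t = true → τ (Function.invFun τ t) = t := fun t ht =>
    Function.invFun_eq (M.surj t ht)
  have hκ' : ∀ K, Function.invFun τ (τ K) = K := Function.leftInverse_invFun M.inj
  let f : ℕ × ℕ × ℕ → PRing 6 ⧸ InIdeal 6 S := fun t =>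
    Ideal.Quotient.mk _ (C (colSign S (Function.invFun τ t)) * X (Function.invFun τ t))
  have hprod : ∀ m, Ideal.Quotient.mk (InIdeal 6 S) (signedMon S m) =
      ((m.toMultiset.map τ).map f).prod := fun m => by
    rw [signedMon_eq_prod, map_multiset_prod, Multiset.map_map, Multiset.map_map]
    refine congrArg _ (Multiset.map_congr rfl fun K _ => ?_)
    simp only [Function.comp_apply, f, hκ']
  have hf : RespectsPairs a b c f := by
    intro p q u v hp hq hu hv hm
    have hpair : ∀ x y, f x * f y = Ideal.Quotient.mk (InIdeal 6 S) (signedMon S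
        (Multiset.toFinsupp {Function.invFun τ x, Function.invFun τ y})) := fun x y => by
      rw [signedMon_toFinsupp, Multiset.insert_eq_cons, Multiset.map_cons, Multiset.map_singleton,
        Multiset.prod_cons, Multiset.prod_singleton, map_mul]
    rw [hpair, hpair]
    refine Ideal.Quotient.eq.2 (M.quadratic_sub_mem hs ?_ ?_ ((M.monWt_eq_iff _ _).2 ?_))
    · rw [Multiset.toFinsupp_toMultiset, Multiset.card_pair]
    · rw [Multiset.toFinsupp_toMultiset, Multiset.card_pair]
    · simp only [Multiset.toFinsupp_toMultiset, Multiset.insert_eq_cons, Multiset.map_cons,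
        Multiset.map_singleton, hκ _ hp, hκ _ hq, hκ _ hu, hκ _ hv]
      exact hm
  refine Ideal.Quotient.eq.1 ?_
  rw [hprod, hprod]
  have hadm : ∀ m : MI 6 →₀ ℕ, ∀ x ∈ m.toMultiset.map τ, admissible a b c x = true :=
    fun m x hx => by
      obtain ⟨K, -, rfl⟩ := Multiset.mem_map.1 hx
      exact M.adm K
  exact prod_eq_of_peelsAll hf (fun _ => mem_triples) (peelsAll_triples M.mem) _ _ _ rfl
    (hadm m) (hadm m') ((M.monWt_eq_iff _ _).1 h)

theorem Model.inIdeal_eq_ker (M : Model S a b c τ) (hs : QuadraticBound) :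
    InIdeal 6 S = RingHom.ker (leadHom S) := by
  refine le_antisymm (Ideal.span_le.2 ?_) (M.ker_leadHom_le (M.signedMon_sub_mem hs))
  rintro _ ⟨f, hf, -, rfl⟩
  exact M.leadHom_inM hf

theorem Model.card_support_signedMon_sub (M : Model S a b c τ) {m m' : MI 6 →₀ ℕ} (h : m ≠ m') :
    (signedMon S m - signedMon S m').support.card = 2 := by
  classical
  have hs : (signedMon S m - signedMon S m').support = {m, m'} := by
    ext k
    rw [Finset.mem_insert, Finset.mem_singleton]
    refine ⟨mem_support_signedMon_sub, ?_⟩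
    rintro (rfl | rfl)
    · simpa [signedMon, coeff_monomial, h.symm] using M.monSign_ne_zero k
    · simpa [signedMon, coeff_monomial, h] using M.monSign_ne_zero k
  rw [hs, Finset.card_pair h]

theorem Model.toric (M : Model S a b c τ) (hs : QuadraticBound) :
    (∃ B : Set (PRing 6), (∀ f ∈ B, f.support.card = 2) ∧ InIdeal 6 S = Ideal.span B) ∧
      (InIdeal 6 S).IsPrime := by
  rw [M.inIdeal_eq_ker hs]
  refine ⟨⟨{f | ∃ m m', m ≠ m' ∧ monWt S m = monWt S m' ∧ f = signedMon S m - signedMon S m'},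
    ?_, le_antisymm (M.ker_leadHom_le fun m m' h => ?_) (Ideal.span_le.2 ?_)⟩,
    RingHom.ker_isPrime _⟩
  · rintro _ ⟨m, m', h, -, rfl⟩
    exact M.card_support_signedMon_sub h
  · by_cases e : m = m'
    · rw [e, sub_self]
      exact zero_mem _
    · exact Ideal.subset_span ⟨m, m', e, h, rfl⟩
  · rintro _ ⟨m, m', -, h, rfl⟩
    rw [SetLike.mem_coe, RingHom.mem_ker, map_sub, M.leadHom_signedMon, M.leadHom_signedMon, h,
      sub_self]

end Toric

/-- The class of a Plücker variable in the Plücker algebra. -/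
noncomputable def pcl (x y z : ℕ) : PRing 6 ⧸ PluckerIdeal 6 :=
  Ideal.Quotient.mkₐ ℂ (PluckerIdeal 6) (pv x y z)

/-- The class of a signed Plücker variable in the Plücker algebra. -/
noncomputable def signedPcl (a b j : ℕ) : PRing 6 ⧸ PluckerIdeal 6 :=
  if j < a then pcl j a b else if j < b then -pcl a j b else pcl a b j

theorem pcl_eq_zero {x y z : ℕ} (h : x = y ∨ y = z) : pcl x y z = 0 := by
  rw [pcl, pv_eq_zero h, map_zero]

theorem sorted_pair {a b : ℕ} (h1 : 1 ≤ a) (h2 : a < b) (h3 : b ≤ 6) : Sorted 2 6 ![a, b] := by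
  refine ⟨?_, ?_⟩
  · rw [Fin.strictMono_iff_lt_succ]
    simp [h2]
  · rw [Fin.forall_fin_two]
    exact ⟨⟨h1, h2.le.trans h3⟩, h1.trans h2.le, h3⟩

theorem sorted_quadruple {a b c d : ℕ} (h1 : 1 ≤ a) (h2 : a < b) (h3 : b < c) (h4 : c < d)
    (h5 : d ≤ 6) : Sorted 4 6 ![a, b, c, d] := by
  refine ⟨?_, ?_⟩
  · rw [Fin.strictMono_iff_lt_succ]
    simp [Fin.forall_fin_succ, h2, h3, h4]
  · simp only [Fin.forall_fin_succ, Matrix.cons_val_zero, Matrix.cons_val_succ]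
    exact ⟨⟨by omega, by omega⟩, ⟨by omega, by omega⟩, ⟨by omega, by omega⟩,
      ⟨by omega, by omega⟩, fun i => i.elim0⟩

theorem pcl_relation {a b c d e f : ℕ} (ha : 1 ≤ a) (hab : a < b) (hb : b ≤ 6) (hc : 1 ≤ c)
    (hcd : c < d) (hde : d < e) (hef : e < f) (hf : f ≤ 6) :
    -(signedPcl a b c * pcl d e f) + signedPcl a b d * pcl c e f - signedPcl a b e * pcl c d f +
      signedPcl a b f * pcl c d e = 0 := by
  have h : Ideal.Quotient.mkₐ ℂ (PluckerIdeal 6) (Rrel 6 ![a, b] ![c, d, e, f]) = 0 :=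
    Ideal.Quotient.eq_zero_iff_mem.2 (Ideal.subset_span
      ⟨_, _, sorted_pair ha hab hb, sorted_quadruple hc hcd hde hef hf, rfl⟩)
  have hs : ∀ j, Ideal.Quotient.mkₐ ℂ (PluckerIdeal 6) (signedPv a b j) = signedPcl a b j :=
    fun j => by
      unfold signedPv signedPcl pcl
      split_ifs <;> simp
  rw [Rrel_eq hab hcd hde hef] at h
  simp only [map_add, map_sub, map_neg, map_mul, hs] at h
  exact h

/-- The product of the classes of two Plücker variables. -/
noncomputable def pairCl (p : (ℕ × ℕ × ℕ) × (ℕ × ℕ × ℕ)) : PRing 6 ⧸ PluckerIdeal 6 :=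
  pcl p.1.1 p.1.2.1 p.1.2.2 * pcl p.2.1 p.2.2.1 p.2.2.2

theorem pairCl_swap (p : (ℕ × ℕ × ℕ) × (ℕ × ℕ × ℕ)) : pairCl p.swap = pairCl p := mul_comm _ _

/-- The semistandard pairs of triples. -/
def standardPairs : Finset ((ℕ × ℕ × ℕ) × (ℕ × ℕ × ℕ)) :=
  (allTriples ×ˢ allTriples).filter fun p =>
    p.1.1 ≤ p.2.1 ∧ p.1.2.1 ≤ p.2.2.1 ∧ p.1.2.2 ≤ p.2.2.2

theorem card_standardPairs : standardPairs.card = 175 := by decide +kernel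

open Classical in
/-- The classes of the semistandard products. -/
noncomputable def standardProducts : Finset (PRing 6 ⧸ PluckerIdeal 6) :=
  standardPairs.image pairCl

/-- The span of the semistandard products. -/
noncomputable def standardSpan : Submodule ℂ (PRing 6 ⧸ PluckerIdeal 6) :=
  Submodule.span ℂ (standardProducts : Set _)

theorem card_standardProducts : standardProducts.card ≤ 175 := by
  classical
  rw [← card_standardPairs, standardProducts]
  exact Finset.card_image_le

theorem pairCl_mem_of_standard {p : (ℕ × ℕ × ℕ) × (ℕ × ℕ × ℕ)} (h : p ∈ standardPairs) :
    pairCl p ∈ standardSpan := by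
  classical
  exact Submodule.subset_span (Finset.mem_coe.2 (Finset.mem_image_of_mem _ h))

theorem mul_mem_standardSpan {x y z u v w : ℕ} (h1 : 1 ≤ x ∧ x < y ∧ y < z ∧ z ≤ 6)
    (h2 : 1 ≤ u ∧ u < v ∧ v < w ∧ w ≤ 6) (h : x ≤ u ∧ y ≤ v ∧ z ≤ w) :
    pcl x y z * pcl u v w ∈ standardSpan := by
  refine pairCl_mem_of_standard (p := ((x, y, z), (u, v, w))) ?_
  simp only [standardPairs, allTriples, Finset.mem_filter, Finset.mem_product, Finset.mem_Icc]
  omega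

/-- The increasing quintuples. -/
def quintuples : List (ℕ × ℕ × ℕ × ℕ × ℕ) :=
  [(1, 2, 3, 4, 5), (1, 2, 3, 4, 6), (1, 2, 3, 5, 6), (1, 2, 4, 5, 6), (1, 3, 4, 5, 6),
    (2, 3, 4, 5, 6)]

theorem bounds_of_mem_quintuples {v w x y z : ℕ} (h : (v, w, x, y, z) ∈ quintuples) :
    1 ≤ v ∧ v < w ∧ w < x ∧ x < y ∧ y < z ∧ z ≤ 6 := by
  simp only [quintuples, List.mem_cons, List.not_mem_nil, or_false, Prod.mk.injEq] at h
  omega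

/-- The incomparable pairs of triples with a common element and union `v < w < x < y < z`. -/
def meetingPairs (q : ℕ × ℕ × ℕ × ℕ × ℕ) : List ((ℕ × ℕ × ℕ) × (ℕ × ℕ × ℕ)) :=
  let (v, w, x, y, z) := q
  [((v, w, z), (v, x, y)), ((v, w, z), (w, x, y)), ((v, x, z), (w, x, y)), ((v, y, z), (w, x, y)),
    ((v, y, z), (w, x, z))]

/-- The incomparable pairs of disjoint triples. -/
def disjointPairs : List ((ℕ × ℕ × ℕ) × (ℕ × ℕ × ℕ)) :=
  [((1, 2, 6), (3, 4, 5)), ((1, 3, 6), (2, 4, 5)), ((1, 4, 5), (2, 3, 6)), ((1, 4, 6), (2, 3, 5)),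
    ((1, 5, 6), (2, 3, 4))]

/-- The incomparable pairs of triples, in one of the two possible orders. -/
def incomparablePairs : List ((ℕ × ℕ × ℕ) × (ℕ × ℕ × ℕ)) :=
  quintuples.flatMap meetingPairs ++ disjointPairs

theorem pairs_check : ∀ p ∈ allTriples ×ˢ allTriples,
    ((p.1.1 ≤ p.2.1 ∧ p.1.2.1 ≤ p.2.2.1 ∧ p.1.2.2 ≤ p.2.2.2) ∨ p ∈ incomparablePairs) ∨
      ((p.2.1 ≤ p.1.1 ∧ p.2.2.1 ≤ p.1.2.1 ∧ p.2.2.2 ≤ p.1.2.2) ∨ p.swap ∈ incomparablePairs) := by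
  decide +kernel

theorem pairCl_mem_of_meeting {q : ℕ × ℕ × ℕ × ℕ × ℕ} (hq : q ∈ quintuples)
    {p : (ℕ × ℕ × ℕ) × (ℕ × ℕ × ℕ)} (hp : p ∈ meetingPairs q) : pairCl p ∈ standardSpan := by
  obtain ⟨v, w, x, y, z⟩ := q
  obtain ⟨h1, h2, h3, h4, h5, h6⟩ := bounds_of_mem_quintuples hq
  have key : ∀ {b₁ b₂ b₃ c₁ c₂ c₃ d₁ d₂ d₃ e₁ e₂ e₃ : ℕ} {a : PRing 6 ⧸ PluckerIdeal 6},
      a = pcl b₁ b₂ b₃ * pcl c₁ c₂ c₃ - pcl d₁ d₂ d₃ * pcl e₁ e₂ e₃ →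
      ((1 ≤ b₁ ∧ b₁ < b₂ ∧ b₂ < b₃ ∧ b₃ ≤ 6) ∧ (1 ≤ c₁ ∧ c₁ < c₂ ∧ c₂ < c₃ ∧ c₃ ≤ 6) ∧
        (b₁ ≤ c₁ ∧ b₂ ≤ c₂ ∧ b₃ ≤ c₃)) →
      ((1 ≤ d₁ ∧ d₁ < d₂ ∧ d₂ < d₃ ∧ d₃ ≤ 6) ∧ (1 ≤ e₁ ∧ e₁ < e₂ ∧ e₂ < e₃ ∧ e₃ ≤ 6) ∧
        (d₁ ≤ e₁ ∧ d₂ ≤ e₂ ∧ d₃ ≤ e₃)) → a ∈ standardSpan := by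
    rintro _ _ _ _ _ _ _ _ _ _ _ _ _ rfl ⟨g1, g2, g3⟩ ⟨g4, g5, g6⟩
    exact Submodule.sub_mem _ (mul_mem_standardSpan g1 g2 g3) (mul_mem_standardSpan g4 g5 g6)
  have hz : ∀ s t, pcl s s t = 0 := fun s t => pcl_eq_zero (Or.inl rfl)
  have hz' : ∀ s t, pcl s t t = 0 := fun s t => pcl_eq_zero (Or.inr rfl)
  simp only [meetingPairs, List.mem_cons, List.not_mem_nil, or_false] at hp
  rcases hp with rfl | rfl | rfl | rfl | rfl
  · have hr := pcl_relation (a := v) (b := w) (c := v) (d := x) (e := y) (f := z)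
      (by omega) (by omega) (by omega) (by omega) (by omega) (by omega) (by omega) (by omega)
    simp (disch := omega) only [signedPcl, if_pos, if_neg, hz] at hr
    refine key (?_ : _ = pcl v w y * pcl v x z - pcl v w x * pcl v y z) (by omega) (by omega)
    rw [pairCl]
    linear_combination hr
  · have hr := pcl_relation (a := v) (b := w) (c := w) (d := x) (e := y) (f := z)
      (by omega) (by omega) (by omega) (by omega) (by omega) (by omega) (by omega) (by omega)
    simp (disch := omega) only [signedPcl, if_neg, hz'] at hr
    refine key (?_ : _ = pcl v w y * pcl w x z - pcl v w x * pcl w y z) (by omega) (by omega)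
    rw [pairCl]
    linear_combination hr
  · have hr := pcl_relation (a := v) (b := x) (c := w) (d := x) (e := y) (f := z)
      (by omega) (by omega) (by omega) (by omega) (by omega) (by omega) (by omega) (by omega)
    simp (disch := omega) only [signedPcl, if_pos, if_neg, hz'] at hr
    refine key (?_ : _ = pcl v x y * pcl w x z - pcl v w x * pcl x y z) (by omega) (by omega)
    rw [pairCl]
    linear_combination hr
  · have hr := pcl_relation (a := v) (b := y) (c := w) (d := x) (e := y) (f := z)
      (by omega) (by omega) (by omega) (by omega) (by omega) (by omega) (by omega) (by omega)
    simp (disch := omega) only [signedPcl, if_pos, if_neg, hz'] at hr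
    refine key (?_ : _ = pcl v x y * pcl w y z - pcl v w y * pcl x y z) (by omega) (by omega)
    rw [pairCl]
    linear_combination hr
  · have hr := pcl_relation (a := v) (b := z) (c := w) (d := x) (e := y) (f := z)
      (by omega) (by omega) (by omega) (by omega) (by omega) (by omega) (by omega) (by omega)
    simp (disch := omega) only [signedPcl, if_pos, if_neg, hz'] at hr
    refine key (?_ : _ = pcl v x z * pcl w y z - pcl v w z * pcl x y z) (by omega) (by omega)
    rw [pairCl]
    linear_combination hr

theorem pairCl_mem_of_disjoint {p : (ℕ × ℕ × ℕ) × (ℕ × ℕ × ℕ)} (hp : p ∈ disjointPairs) :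
    pairCl p ∈ standardSpan := by
  have s1 : pcl 1 2 3 * pcl 4 5 6 ∈ standardSpan := by apply mul_mem_standardSpan <;> norm_num
  have s2 : pcl 1 2 4 * pcl 3 5 6 ∈ standardSpan := by apply mul_mem_standardSpan <;> norm_num
  have s3 : pcl 1 2 5 * pcl 3 4 6 ∈ standardSpan := by apply mul_mem_standardSpan <;> norm_num
  have s4 : pcl 1 3 4 * pcl 2 5 6 ∈ standardSpan := by apply mul_mem_standardSpan <;> norm_num
  have s5 : pcl 1 3 5 * pcl 2 4 6 ∈ standardSpan := by apply mul_mem_standardSpan <;> norm_num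
  have hrel : ∀ a b c d e f : ℕ, (1 ≤ a ∧ a < b ∧ b ≤ 6) →
      (1 ≤ c ∧ c < d ∧ d < e ∧ e < f ∧ f ≤ 6) → _ := fun a b c d e f h h' =>
    pcl_relation h.1 h.2.1 h.2.2 h'.1 h'.2.1 h'.2.2.1 h'.2.2.2.1 h'.2.2.2.2
  have r1 := hrel 1 2 3 4 5 6 (by norm_num) (by norm_num)
  have r2 := hrel 1 3 2 4 5 6 (by norm_num) (by norm_num)
  have r3 := hrel 2 6 1 3 4 5 (by norm_num) (by norm_num)
  have r4 := hrel 4 6 1 2 3 5 (by norm_num) (by norm_num)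
  have r5 := hrel 5 6 1 2 3 4 (by norm_num) (by norm_num)
  norm_num [signedPcl] at r1 r2 r3 r4 r5
  have hadd := @Submodule.add_mem _ _ _ _ _ standardSpan
  have hsub := @Submodule.sub_mem _ _ _ _ _ standardSpan
  simp only [disjointPairs, List.mem_cons, List.not_mem_nil, or_false] at hp
  rcases hp with rfl | rfl | rfl | rfl | rfl
  · convert hadd (hsub s1 s2) s3 using 1
    rw [pairCl]
    linear_combination r1
  · convert hsub (hsub s5 s1) s4 using 1
    rw [pairCl]
    linear_combination r2
  · convert hsub (hadd (hsub s2 s1) s5) (hadd s3 s4) using 1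
    rw [pairCl]
    linear_combination -r1 - r3
  · convert hsub s5 (hadd s1 s3) using 1
    rw [pairCl]
    linear_combination -r4
  · convert hadd (hsub s4 s2) s1 using 1
    rw [pairCl]
    linear_combination -r5

theorem pairCl_mem {p : (ℕ × ℕ × ℕ) × (ℕ × ℕ × ℕ)} (hp : p ∈ allTriples ×ˢ allTriples) :
    pairCl p ∈ standardSpan := by
  have h : ∀ p ∈ incomparablePairs, pairCl p ∈ standardSpan := fun p hp => by
    rw [incomparablePairs, List.mem_append, List.mem_flatMap] at hp
    rcases hp with ⟨q, hq, hp⟩ | hp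
    · exact pairCl_mem_of_meeting hq hp
    · exact pairCl_mem_of_disjoint hp
  have hp' := Finset.mem_product.1 hp
  rcases pairs_check p hp with (h1 | h1) | h1 | h1
  · exact pairCl_mem_of_standard (Finset.mem_filter.2 ⟨hp, h1⟩)
  · exact h _ h1
  · rw [← pairCl_swap]
    exact pairCl_mem_of_standard (Finset.mem_filter.2
      ⟨Finset.mem_product.2 ⟨hp'.2, hp'.1⟩, h1⟩)
  · rw [← pairCl_swap]
    exact h _ h1

theorem quadraticBound : QuadraticBound := by
  refine ⟨standardProducts, card_standardProducts, fun K L => ?_⟩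
  have hm : ∀ K : MI 6, (K.1 0, K.1 1, K.1 2) ∈ allTriples := fun K => by
    have := MI.bounds K
    simp only [allTriples, Finset.mem_filter, Finset.mem_product, Finset.mem_Icc]
    omega
  have hX : ∀ K : MI 6, Ideal.Quotient.mkₐ ℂ (PluckerIdeal 6) (X K) =
      pcl (K.1 0) (K.1 1) (K.1 2) := fun K => by
    have e : ![K.1 0, K.1 1, K.1 2] = K.1 := by
      funext t
      fin_cases t <;> rfl
    rw [pcl, pv, e, pvar_of_sorted K.2]
  have h := pairCl_mem (p := ((K.1 0, K.1 1, K.1 2), (L.1 0, L.1 1, L.1 2)))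
    (Finset.mem_product.2 ⟨hm K, hm L⟩)
  simp only [pairCl, ← hX, ← map_mul, standardSpan] at h
  exact h

end Gr36

/-- For every iterated sequence `S` for `Gr(3,6)`, the initial ideal `In_{M_S}(𝓘_{3,6})`
is toric: it is generated by binomials (polynomials with exactly two terms) and is
prime. -/
theorem initial_ideal_toric (S : List (ℕ × ℕ)) (hS : IsIter 6 S) :
    (∃ B : Set (PRing 6), (∀ f ∈ B, f.support.card = 2) ∧ InIdeal 6 S = Ideal.span B) ∧
    (InIdeal 6 S).IsPrime := by
  obtain ⟨a, b, c, τ, M⟩ := Gr36.exists_model hS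
  exact M.toric Gr36.quadraticBound
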